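/- arXiv:0911.4067 — 13 statements merged into one kernel-verified Lean document; each statement's English description precedes it below -/
import Mathlib

section
/- Let (n, ⟨,⟩) be a finite-dimensional 2-step nilpotent real Lie algebra with a metric whose restriction to the center z is nondegenerate, let v = z^⊥ and let j be the associated map. Then every automorphism ψ of the Lie algebra n that preserves ⟨,⟩ leaves z and v invariant, and the group of orthogonal automorphisms of (n, ⟨,⟩) is isomorphic, via ψ ↦ (ψ|_z, ψ|_v), to the group {(φ, T) ∈ O(z, ⟨,⟩|_z) × O(v, ⟨,⟩|_v) : T j(x) T⁻¹ = j(φx) for all x ∈ z}. -/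
/-- For a finite-dimensional 2-step nilpotent real metric Lie
algebra `(n, B)` with nondegenerate center `z`, `v = z^⊥` and associated map
`j`, every orthogonal automorphism `ψ` of `(n, B)` leaves `z` and `v`
invariant, and `ψ ↦ (ψ|_z, ψ|_v)` is a bijection from the orthogonal
automorphisms of `(n, B)` onto
`{(φ, T) ∈ O(z) × O(v) : T j(x) T⁻¹ = j(φ x) for all x ∈ z}`. -/
theorem statement3 {n : Type} [LieRing n] [LieAlgebra ℝ n] [Module.Finite ℝ n]
    (B : LinearMap.BilinForm ℝ n) (hsymm : B.IsSymm) (hnd : B.Nondegenerate)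
    (h2a : ∃ x y : n, ⁅x, y⁆ ≠ 0) (h2b : ∀ x y w : n, ⁅⁅x, y⁆, w⁆ = 0)
    (z : Submodule ℝ n) (hz : ∀ x : n, x ∈ z ↔ ∀ y : n, ⁅x, y⁆ = 0)
    (hznd : (B.restrict z).Nondegenerate)
    (v : Submodule ℝ n) (hv : v = B.orthogonal z)
    (j : z →ₗ[ℝ] Module.End ℝ v)
    (hjdef : ∀ (x : z) (u w : v),
      B (j x u : n) (w : n) = B ⁅(u : n), (w : n)⁆ (x : n)) :
    -- (1) every orthogonal automorphism leaves `z` and `v` invariant and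
    -- satisfies the compatibility relation `ψ|_v ∘ j(x) = j(ψ|_z x) ∘ ψ|_v`:
    (∀ ψ : n ≃ₗ[ℝ] n, (∀ a b : n, ψ ⁅a, b⁆ = ⁅ψ a, ψ b⁆) →
      (∀ a b : n, B (ψ a) (ψ b) = B a b) →
      ∃ (hzinv : ∀ x : z, ψ (x : n) ∈ z) (hvinv : ∀ u : v, ψ (u : n) ∈ v),
        ∀ (x : z) (u : v),
          ψ (j x u : n) = (j ⟨ψ (x : n), hzinv x⟩ ⟨ψ (u : n), hvinv u⟩ : n)) ∧
    -- (2) injectivity: an orthogonal automorphism is determined by its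
    -- restrictions to `z` and `v`:
    (∀ ψ₁ ψ₂ : n ≃ₗ[ℝ] n,
      (∀ a b : n, ψ₁ ⁅a, b⁆ = ⁅ψ₁ a, ψ₁ b⁆) → (∀ a b : n, B (ψ₁ a) (ψ₁ b) = B a b) →
      (∀ a b : n, ψ₂ ⁅a, b⁆ = ⁅ψ₂ a, ψ₂ b⁆) → (∀ a b : n, B (ψ₂ a) (ψ₂ b) = B a b) →
      (∀ x : z, ψ₁ (x : n) = ψ₂ (x : n)) → (∀ u : v, ψ₁ (u : n) = ψ₂ (u : n)) →
      ψ₁ = ψ₂) ∧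
    -- (3) surjectivity: every pair `(φ, T) ∈ O(z) × O(v)` with
    -- `T j(x) T⁻¹ = j(φ x)` arises as the restrictions of an orthogonal
    -- automorphism of `(n, B)`:
    (∀ (φ : z ≃ₗ[ℝ] z) (T : v ≃ₗ[ℝ] v),
      (∀ x y : z, B (φ x : n) (φ y : n) = B (x : n) (y : n)) →
      (∀ u w : v, B (T u : n) (T w : n) = B (u : n) (w : n)) →
      (∀ (x : z) (u : v), T (j x u) = j (φ x) (T u)) →
      ∃ ψ : n ≃ₗ[ℝ] n, (∀ a b : n, ψ ⁅a, b⁆ = ⁅ψ a, ψ b⁆) ∧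
        (∀ a b : n, B (ψ a) (ψ b) = B a b) ∧
        (∀ x : z, ψ (x : n) = (φ x : n)) ∧ (∀ u : v, ψ (u : n) = (T u : n))) := by
  have hB : ∀ a b : n, B a b = B b a := fun a b => hsymm.eq a b
  have hc : IsCompl z v := by
    rw [hv]
    exact LinearMap.BilinForm.isCompl_orthogonal_of_restrict_nondegenerate hsymm.isRefl hznd
  have horth : ∀ x ∈ z, ∀ u ∈ v, B x u = 0 := by
    intro x hx u hu
    rw [hv, LinearMap.BilinForm.mem_orthogonal_iff] at hu
    exact hu x hx
  have hmemv : ∀ u : n, (∀ x ∈ z, B x u = 0) → u ∈ v := by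
    intro u hu
    rw [hv, LinearMap.BilinForm.mem_orthogonal_iff]
    exact hu
  have hdec : ∀ a : n, ∃ (x : z) (u : v), a = (x : n) + (u : n) := by
    intro a
    have ha : a ∈ z ⊔ v := by rw [hc.sup_eq_top]; trivial
    obtain ⟨x, hx, u, hu, h⟩ := Submodule.mem_sup.mp ha
    exact ⟨⟨x, hx⟩, ⟨u, hu⟩, h.symm⟩
  have nd : ∀ a : n, (∀ b, B a b = 0) → a = 0 := fun a h => hnd.1 a h
  have vnd : ∀ a ∈ v, ∀ b ∈ v, (∀ w ∈ v, B a w = B b w) → a = b := by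
    intro a ha b hb h
    refine sub_eq_zero.mp (nd _ fun c => ?_)
    obtain ⟨x, u, rfl⟩ := hdec c
    have h1 := horth x x.2 a ha
    have h2 := horth x x.2 b hb
    have h3 := h u u.2
    rw [hB] at h1 h2
    simp [h1, h2, h3]
  have znd : ∀ a ∈ z, ∀ b ∈ z, (∀ w ∈ z, B a w = B b w) → a = b := by
    intro a ha b hb h
    refine sub_eq_zero.mp (nd _ fun c => ?_)
    obtain ⟨x, u, rfl⟩ := hdec c
    have h1 := horth a ha u u.2
    have h2 := horth b hb u u.2
    have h3 := h x x.2
    simp [h1, h2, h3]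
  have hbr : ∀ a b : n, ⁅a, b⁆ ∈ z := fun a b => (hz _).2 (h2b a b)
  have hl : ∀ x ∈ z, ∀ y : n, ⁅x, y⁆ = 0 := fun x hx => (hz x).1 hx
  have hr : ∀ x ∈ z, ∀ y : n, ⁅y, x⁆ = 0 := by
    intro x hx y
    rw [← lie_skew, hl x hx, neg_zero]
  refine ⟨?_, ?_, ?_⟩
  · intro ψ hψ hψB
    have hzi : ∀ x ∈ z, ψ x ∈ z := by
      intro x hx
      rw [hz]
      intro y
      rw [← ψ.apply_symm_apply y, ← hψ, hl x hx, map_zero]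
    have hzi' : ∀ x ∈ z, ψ.symm x ∈ z := by
      intro x hx
      rw [hz]
      intro y
      apply ψ.injective
      rw [hψ, ψ.apply_symm_apply, hl x hx, map_zero]
    have hvi : ∀ u ∈ v, ψ u ∈ v := by
      intro u hu
      refine hmemv _ fun x hx => ?_
      rw [← ψ.apply_symm_apply x, hψB]
      exact horth _ (hzi' x hx) u hu
    have hvi' : ∀ u ∈ v, ψ.symm u ∈ v := by
      intro u hu
      refine hmemv _ fun x hx => ?_
      rw [← hψB, ψ.apply_symm_apply]
      exact horth _ (hzi x hx) u hu
    refine ⟨fun x => hzi x x.2, fun u => hvi u u.2, fun x u => ?_⟩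
    refine vnd _ (hvi _ (j x u).2) _ (Subtype.property _) fun w hw => ?_
    have e1 := hjdef x u ⟨ψ.symm w, hvi' w hw⟩
    have e2 := hjdef ⟨ψ x, hzi x x.2⟩ ⟨ψ u, hvi u u.2⟩ ⟨w, hw⟩
    simp only at e1 e2
    rw [e2]
    rw [← hψB, ψ.apply_symm_apply, ← hψB ⁅_, _⁆, hψ, ψ.apply_symm_apply] at e1
    exact e1
  · intro ψ₁ ψ₂ _ _ _ _ h1 h2
    ext a
    obtain ⟨x, u, rfl⟩ := hdec a
    rw [map_add, map_add, h1, h2]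
  · intro φ T hφ hT hj
    let E := Submodule.prodEquivOfIsCompl z v hc
    let ψ : n ≃ₗ[ℝ] n := E.symm ≪≫ₗ (LinearEquiv.prodCongr φ T) ≪≫ₗ E
    have hψ : ∀ (x : z) (u : v), ψ ((x : n) + (u : n)) = (φ x : n) + (T u : n) := by
      intro x u
      have : (x : n) + (u : n) = E (x, u) := by simp [E]
      rw [this]
      simp only [ψ, LinearEquiv.trans_apply, LinearEquiv.symm_apply_apply]
      simp [E]
    have hψz : ∀ x : z, ψ (x : n) = (φ x : n) := by
      intro x
      simpa using hψ x 0
    have hψv : ∀ u : v, ψ (u : n) = (T u : n) := by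
      intro u
      simpa using hψ 0 u
    refine ⟨ψ, ?_, ?_, hψz, hψv⟩
    · intro a b
      obtain ⟨x, u, rfl⟩ := hdec a
      obtain ⟨y, w, rfl⟩ := hdec b
      rw [hψ, hψ]
      simp only [add_lie, lie_add, hl _ x.2, hr _ y.2, hl _ (φ x).2, hr _ (φ y).2, zero_add]
      have e0 := hψz ⟨⁅(u : n), (w : n)⁆, hbr _ _⟩
      simp only at e0
      rw [e0]
      refine znd _ (Subtype.property _) _ (hbr _ _) fun c hcz => ?_
      obtain ⟨t, ht⟩ := φ.surjective ⟨c, hcz⟩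
      have ht' : c = (φ t : n) := by rw [ht]
      rw [ht', hφ, ← hjdef (φ t), ← hj, hT, hjdef]
    · intro a b
      obtain ⟨x, u, rfl⟩ := hdec a
      obtain ⟨y, w, rfl⟩ := hdec b
      rw [hψ, hψ]
      have h1 := horth x x.2 w w.2
      have h2 := horth y y.2 u u.2
      have h3 := horth _ (φ x).2 _ (T w).2
      have h4 := horth _ (φ y).2 _ (T u).2
      rw [hB] at h2 h4
      simp [h1, h2, h3, h4, hφ, hT]
end

section
/- Let (n, ⟨,⟩) be a finite-dimensional 2-step nilpotent real Lie algebra with a metric whose restriction to the center z is nondegenerate, let v = z^⊥ and let j be the associated map. Then every derivation D of n that is skew-adjoint with respect to ⟨,⟩ leaves z and v invariant, and the Lie algebra h = Der(n) ∩ so(n, ⟨,⟩) is isomorphic, via D ↦ (D|_z, D|_v), to {(A, B) ∈ so(z, ⟨,⟩|_z) × so(v, ⟨,⟩|_v) : B j(x) − j(x) B = j(Ax) for all x ∈ z}. -/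
/-- For a finite-dimensional 2-step nilpotent real metric Lie
algebra `(n, B)` with nondegenerate center `z`, `v = z^⊥` and associated map
`j`, every skew-adjoint derivation `D` of `(n, B)` leaves `z` and `v`
invariant, and `D ↦ (D|_z, D|_v)` is a bijection from
`h = Der(n) ∩ so(n, B)` onto
`{(A, C) ∈ so(z) × so(v) : C j(x) − j(x) C = j(Ax) for all x ∈ z}`. -/
theorem statement4 {n : Type} [LieRing n] [LieAlgebra ℝ n] [Module.Finite ℝ n]
    (B : LinearMap.BilinForm ℝ n) (hsymm : B.IsSymm) (hnd : B.Nondegenerate)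
    (h2a : ∃ x y : n, ⁅x, y⁆ ≠ 0) (h2b : ∀ x y w : n, ⁅⁅x, y⁆, w⁆ = 0)
    (z : Submodule ℝ n) (hz : ∀ x : n, x ∈ z ↔ ∀ y : n, ⁅x, y⁆ = 0)
    (hznd : (B.restrict z).Nondegenerate)
    (v : Submodule ℝ n) (hv : v = B.orthogonal z)
    (j : z →ₗ[ℝ] Module.End ℝ v)
    (hjdef : ∀ (x : z) (u w : v),
      B (j x u : n) (w : n) = B ⁅(u : n), (w : n)⁆ (x : n)) :
    -- (1) every skew-adjoint derivation leaves `z` and `v` invariant, its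
    -- restrictions `A = D|_z`, `C = D|_v` are skew-adjoint, and
    -- `C j(x) − j(x) C = j(Ax)` for all `x ∈ z`:
    (∀ D : Module.End ℝ n, (∀ a b : n, D ⁅a, b⁆ = ⁅D a, b⁆ + ⁅a, D b⁆) →
      (∀ a b : n, B (D a) b = - B a (D b)) →
      ∃ (hzinv : ∀ x : z, D (x : n) ∈ z) (hvinv : ∀ u : v, D (u : n) ∈ v),
        (∀ x y : z, B (D (x : n)) (y : n) = - B (x : n) (D (y : n))) ∧
        (∀ u w : v, B (D (u : n)) (w : n) = - B (u : n) (D (w : n))) ∧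
        (∀ (x : z) (u : v),
          D (j x u : n) - (j x ⟨D (u : n), hvinv u⟩ : n)
            = (j ⟨D (x : n), hzinv x⟩ u : n))) ∧
    -- (2) injectivity: a skew-adjoint derivation is determined by its
    -- restrictions to `z` and `v`:
    (∀ D₁ D₂ : Module.End ℝ n,
      (∀ a b : n, D₁ ⁅a, b⁆ = ⁅D₁ a, b⁆ + ⁅a, D₁ b⁆) →
      (∀ a b : n, B (D₁ a) b = - B a (D₁ b)) →
      (∀ a b : n, D₂ ⁅a, b⁆ = ⁅D₂ a, b⁆ + ⁅a, D₂ b⁆) →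
      (∀ a b : n, B (D₂ a) b = - B a (D₂ b)) →
      (∀ x : z, D₁ (x : n) = D₂ (x : n)) → (∀ u : v, D₁ (u : n) = D₂ (u : n)) →
      D₁ = D₂) ∧
    -- (3) surjectivity: every pair `(A, C) ∈ so(z) × so(v)` with
    -- `C j(x) − j(x) C = j(Ax)` arises from a skew-adjoint derivation:
    (∀ (A : Module.End ℝ z) (C : Module.End ℝ v),
      (∀ x y : z, B (A x : n) (y : n) = - B (x : n) (A y : n)) →
      (∀ u w : v, B (C u : n) (w : n) = - B (u : n) (C w : n)) →
      (∀ (x : z) (u : v), C (j x u) - j x (C u) = j (A x) u) →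
      ∃ D : Module.End ℝ n, (∀ a b : n, D ⁅a, b⁆ = ⁅D a, b⁆ + ⁅a, D b⁆) ∧
        (∀ a b : n, B (D a) b = - B a (D b)) ∧
        (∀ x : z, D (x : n) = (A x : n)) ∧ (∀ u : v, D (u : n) = (C u : n))) := by
  have hs : ∀ a b : n, B a b = B b a := fun a b => hsymm.eq a b
  have hc : IsCompl z v := by
    rw [hv]
    exact LinearMap.BilinForm.isCompl_orthogonal_of_restrict_nondegenerate hsymm.isRefl hznd
  have hzv : ∀ (x : z) (u : v), B (x : n) (u : n) = 0 := by
    intro x u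
    have hu : (u : n) ∈ B.orthogonal z := hv.le u.2
    rw [LinearMap.BilinForm.mem_orthogonal_iff] at hu
    exact hu _ x.2
  have hvz : ∀ (u : v) (x : z), B (u : n) (x : n) = 0 := fun u x => by rw [hs]; exact hzv x u
  have hdec : ∀ a : n, ∃ (x : z) (u : v), a = x + u := by
    intro a
    have ha : a ∈ z ⊔ v := by rw [hc.sup_eq_top]; trivial
    obtain ⟨x, hx, u, hu, h⟩ := Submodule.mem_sup.1 ha
    exact ⟨⟨x, hx⟩, ⟨u, hu⟩, h.symm⟩
  have hzero : ∀ a : n, (∀ b, B a b = 0) → a = 0 := fun a ha => hnd.1 a ha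
  have hv0 : ∀ u : v, (∀ w : v, B (u : n) (w : n) = 0) → (u : n) = 0 := by
    intro u hu
    apply hzero
    intro b
    obtain ⟨y, w, rfl⟩ := hdec b
    rw [map_add, hvz, hu, add_zero]
  have hz0 : ∀ x : z, (∀ y : z, B (x : n) (y : n) = 0) → (x : n) = 0 := by
    intro u hu
    apply hzero
    intro b
    obtain ⟨y, w, rfl⟩ := hdec b
    rw [map_add, hzv, hu, add_zero]
  have hzl : ∀ (x : z) (b : n), ⁅(x : n), b⁆ = 0 := fun x b => (hz x).1 x.2 b
  have hzr : ∀ (x : z) (b : n), ⁅b, (x : n)⁆ = 0 := fun x b => by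
    rw [← lie_skew, hzl, neg_zero]
  have hbr : ∀ a b : n, ⁅a, b⁆ ∈ z := fun a b => (hz _).2 (h2b a b)
  refine ⟨?_, ?_, ?_⟩
  · intro D hD hsk
    have hzinv : ∀ x : z, D (x : n) ∈ z := by
      intro x
      rw [hz]
      intro y
      have h := hD x y
      rw [hzl, hzl, map_zero, add_zero] at h
      exact h.symm
    have hvinv : ∀ u : v, D (u : n) ∈ v := by
      intro u
      have : D (u : n) ∈ B.orthogonal z := by
        rw [LinearMap.BilinForm.mem_orthogonal_iff]
        intro x hx
        change B x (D u) = 0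
        have h := hsk x u
        have h2 := hzv ⟨D x, hzinv ⟨x, hx⟩⟩ u
        simp only at h2
        linarith
      exact hv.ge this
    refine ⟨hzinv, hvinv, fun x y => hsk x y, fun u w => hsk u w, ?_⟩
    intro x u
    rw [← sub_eq_zero]
    refine hv0 (⟨D (j x u : n), hvinv (j x u)⟩ - j x ⟨D (u : n), hvinv u⟩
      - j ⟨D (x : n), hzinv x⟩ u) ?_
    intro w
    have e1 := hjdef x u ⟨D w, hvinv w⟩
    have e2 := hjdef x ⟨D u, hvinv u⟩ w
    have e3 := hjdef ⟨D x, hzinv x⟩ u w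
    have e4 := hsk (j x u : n) w
    have e5 := hsk ⁅(u : n), (w : n)⁆ x
    rw [hD, map_add, LinearMap.add_apply] at e5
    simp only [Submodule.coe_sub, map_sub, LinearMap.sub_apply] at *
    linarith
  · intro D₁ D₂ _ _ _ _ h1 h2
    ext a
    obtain ⟨x, u, rfl⟩ := hdec a
    rw [map_add, map_add, h1, h2]
  · intro A C hA hC hAC
    let D : Module.End ℝ n := LinearMap.ofIsCompl hc (z.subtype ∘ₗ A) (v.subtype ∘ₗ C)
    have hDz : ∀ x : z, D (x : n) = (A x : n) := fun x => by
      simp [D]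
    have hDv : ∀ x : v, D (x : n) = (C x : n) := fun x => by
      simp [D]
    refine ⟨D, ?_, ?_, hDz, hDv⟩
    · intro a b
      obtain ⟨x, u, rfl⟩ := hdec a
      obtain ⟨y, w, rfl⟩ := hdec b
      simp only [map_add, hDz, hDv, add_lie, lie_add, hzl, hzr, zero_add, add_zero]
      have h := hDz ⟨⁅(u : n), (w : n)⁆, hbr _ _⟩
      simp only at h
      rw [h, ← sub_eq_zero]
      refine hz0 (A ⟨⁅(u : n), (w : n)⁆, hbr _ _⟩ - (⟨⁅(C u : n), (w : n)⁆, hbr _ _⟩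
        + ⟨⁅(u : n), (C w : n)⁆, hbr _ _⟩)) ?_
      intro t
      have e1 := hjdef t u (C w)
      have e2 := hjdef t (C u) w
      have e3 := hjdef (A t) u w
      have e4 := hC (j t u) w
      have e5 := hA ⟨⁅(u : n), (w : n)⁆, hbr _ _⟩ t
      rw [← hAC] at e3
      simp only [Submodule.coe_sub, Submodule.coe_add, map_sub, map_add, LinearMap.sub_apply,
        LinearMap.add_apply] at *
      linarith
    · intro a b
      obtain ⟨x, u, rfl⟩ := hdec a
      obtain ⟨y, w, rfl⟩ := hdec b
      simp only [map_add, hDz, hDv, LinearMap.add_apply, hzv, hvz, hA x y, hC u w]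
      ring
end

section
/- Let (n, ⟨,⟩) be a finite-dimensional 2-step nilpotent real Lie algebra with a metric whose restriction to the center z is nondegenerate, let v = z^⊥, let j be the associated map, and assume j is injective. Let h = Der(n) ∩ so(n, ⟨,⟩). Then: (i) every φ ∈ h leaves each of z and v invariant; (ii) for every φ ∈ h one has j(φ|_z x) = [φ|_v, j(x)] for all x ∈ z, i.e. φ|_z = j⁻¹ ∘ ad_{so(v)}(φ|_v) ∘ j; in particular the map φ ↦ φ|_v is an injective Lie algebra homomorphism of h onto a Lie subalgebra of so(v, ⟨,⟩|_v). -/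
/-- **Lemma 3.1 (i)–(ii).**  For a finite-dimensional 2-step
nilpotent real metric Lie algebra `(n, B)` with nondegenerate center `z`,
`v = z^⊥` and injective associated map `j`, every element
`φ ∈ h = Der(n) ∩ so(n, B)` leaves `z` and `v` invariant and satisfies
`j(φ|_z x) = [φ|_v, j(x)]`, i.e. `φ|_z = j⁻¹ ∘ ad_{so(v)}(φ|_v) ∘ j`;
in particular `φ ↦ φ|_v` is an injective Lie algebra homomorphism of `h`
onto a Lie subalgebra of `so(v, B|_v)`. -/
theorem statement5 {n : Type} [LieRing n] [LieAlgebra ℝ n] [Module.Finite ℝ n]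
    (B : LinearMap.BilinForm ℝ n) (hsymm : B.IsSymm) (hnd : B.Nondegenerate)
    (h2a : ∃ x y : n, ⁅x, y⁆ ≠ 0) (h2b : ∀ x y w : n, ⁅⁅x, y⁆, w⁆ = 0)
    (z : Submodule ℝ n) (hz : ∀ x : n, x ∈ z ↔ ∀ y : n, ⁅x, y⁆ = 0)
    (hznd : (B.restrict z).Nondegenerate)
    (v : Submodule ℝ n) (hv : v = B.orthogonal z)
    (j : z →ₗ[ℝ] Module.End ℝ v)
    (hjdef : ∀ (x : z) (u w : v),
      B (j x u : n) (w : n) = B ⁅(u : n), (w : n)⁆ (x : n))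
    (hjinj : Function.Injective j) :
    -- (i) every `φ ∈ h` leaves `z` and `v` invariant, and
    -- (ii) `j(φ|_z x) = φ|_v ∘ j(x) − j(x) ∘ φ|_v` for all `x ∈ z`:
    (∀ D : Module.End ℝ n, (∀ a b : n, D ⁅a, b⁆ = ⁅D a, b⁆ + ⁅a, D b⁆) →
      (∀ a b : n, B (D a) b = - B a (D b)) →
      ∃ (hzinv : ∀ x : z, D (x : n) ∈ z) (hvinv : ∀ u : v, D (u : n) ∈ v),
        ∀ (x : z) (u : v),
          (j ⟨D (x : n), hzinv x⟩ u : n)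
            = D (j x u : n) - (j x ⟨D (u : n), hvinv u⟩ : n)) ∧
    -- `φ ↦ φ|_v` is injective on `h`:
    (∀ D₁ D₂ : Module.End ℝ n,
      (∀ a b : n, D₁ ⁅a, b⁆ = ⁅D₁ a, b⁆ + ⁅a, D₁ b⁆) →
      (∀ a b : n, B (D₁ a) b = - B a (D₁ b)) →
      (∀ a b : n, D₂ ⁅a, b⁆ = ⁅D₂ a, b⁆ + ⁅a, D₂ b⁆) →
      (∀ a b : n, B (D₂ a) b = - B a (D₂ b)) →
      (∀ u : v, D₁ (u : n) = D₂ (u : n)) → D₁ = D₂) ∧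
    -- `h` is closed under commutators (so the image of `φ ↦ φ|_v`, the
    -- restriction being a Lie algebra homomorphism, is a Lie subalgebra
    -- of `so(v, B|_v)`):
    (∀ D₁ D₂ : Module.End ℝ n,
      (∀ a b : n, D₁ ⁅a, b⁆ = ⁅D₁ a, b⁆ + ⁅a, D₁ b⁆) →
      (∀ a b : n, B (D₁ a) b = - B a (D₁ b)) →
      (∀ a b : n, D₂ ⁅a, b⁆ = ⁅D₂ a, b⁆ + ⁅a, D₂ b⁆) →
      (∀ a b : n, B (D₂ a) b = - B a (D₂ b)) →
      (∀ a b : n, ⁅D₁, D₂⁆ ⁅a, b⁆ = ⁅⁅D₁, D₂⁆ a, b⁆ + ⁅a, ⁅D₁, D₂⁆ b⁆) ∧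
      (∀ a b : n, B (⁅D₁, D₂⁆ a) b = - B a (⁅D₁, D₂⁆ b))) := by
  have sym : ∀ a b, B a b = B b a := fun a b => by simpa using hsymm.eq a b
  have hvm : ∀ u : n, u ∈ v ↔ ∀ x ∈ z, B x u = 0 := by
    intro u
    rw [hv, LinearMap.BilinForm.mem_orthogonal_iff]
  have hc : IsCompl z v := by
    rw [hv]
    exact LinearMap.BilinForm.isCompl_orthogonal_of_restrict_nondegenerate hsymm.isRefl hznd
  have hdec : ∀ a : n, ∃ x ∈ z, ∃ u ∈ v, x + u = a := fun a =>
    Submodule.mem_sup.1 (hc.sup_eq_top ▸ Submodule.mem_top)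
  have hzero : ∀ p ∈ v, (∀ w ∈ v, B p w = 0) → p = 0 := by
    intro p hp h
    apply hnd.1 p
    intro a
    obtain ⟨x, hx, u, hu, rfl⟩ := hdec a
    rw [map_add, h u hu, sym p x, (hvm p).1 hp x hx, add_zero]
  have main : ∀ D : Module.End ℝ n, (∀ a b : n, D ⁅a, b⁆ = ⁅D a, b⁆ + ⁅a, D b⁆) →
      (∀ a b : n, B (D a) b = - B a (D b)) →
      ∃ (hzinv : ∀ x : z, D (x : n) ∈ z) (hvinv : ∀ u : v, D (u : n) ∈ v),
        ∀ (x : z) (u : v),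
          (j ⟨D (x : n), hzinv x⟩ u : n)
            = D (j x u : n) - (j x ⟨D (u : n), hvinv u⟩ : n) := by
    intro D hD hB
    have hzinv : ∀ x : z, D (x : n) ∈ z := by
      intro x
      rw [hz]
      intro y
      have h := hD x y
      rw [(hz x).1 x.2 y, (hz x).1 x.2 (D y), map_zero, add_zero] at h
      exact h.symm
    have hvinv : ∀ u : v, D (u : n) ∈ v := by
      intro u
      rw [hvm]
      intro x hx
      have h := hB x u
      rw [(hvm u).1 u.2 _ (hzinv ⟨x, hx⟩)] at h
      linarith
    refine ⟨hzinv, hvinv, fun x u => ?_⟩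
    rw [← sub_eq_zero]
    apply hzero
    · exact v.sub_mem (Subtype.mem _) (v.sub_mem (hvinv _) (Subtype.mem _))
    · intro w hw
      have h1 := hjdef ⟨D x, hzinv x⟩ u ⟨w, hw⟩
      have h2 := hjdef x u ⟨D w, hvinv ⟨w, hw⟩⟩
      have h3 := hjdef x ⟨D u, hvinv u⟩ ⟨w, hw⟩
      have h4 := hB (j x u) w
      have h5 := hB ⁅(u : n), w⁆ x
      rw [hD, map_add, LinearMap.add_apply] at h5
      simp only [map_sub, LinearMap.sub_apply]
      simp only at h1 h2 h3
      linarith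
  refine ⟨main, ?_, ?_⟩
  · intro D₁ D₂ h1 b1 h2 b2 h
    obtain ⟨z1, v1, e1⟩ := main D₁ h1 b1
    obtain ⟨z2, v2, e2⟩ := main D₂ h2 b2
    ext a
    obtain ⟨x, hx, u, hu, rfl⟩ := hdec a
    have hu' := h ⟨u, hu⟩
    have hx' : (⟨D₁ x, z1 ⟨x, hx⟩⟩ : z) = ⟨D₂ x, z2 ⟨x, hx⟩⟩ := by
      apply hjinj
      ext w
      have e1' := e1 ⟨x, hx⟩ w
      have e2' := e2 ⟨x, hx⟩ w
      have hw : (⟨D₁ w, v1 w⟩ : v) = ⟨D₂ w, v2 w⟩ := Subtype.ext (h w)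
      rw [hw, h] at e1'
      exact e1'.trans e2'.symm
    rw [map_add, map_add]
    exact congrArg₂ (· + ·) (Subtype.ext_iff.1 hx') hu'
  · intro D₁ D₂ h1 b1 h2 b2
    constructor
    · intro a b
      simp only [Ring.lie_def, LinearMap.sub_apply, Module.End.mul_apply, h1, h2, map_add,
        sub_lie, lie_sub]
      abel
    · intro a b
      simp only [Ring.lie_def, LinearMap.sub_apply, Module.End.mul_apply, b1, b2, map_sub]
      ring
end

section
/- Let (n, ⟨,⟩) be a finite-dimensional 2-step nilpotent real Lie algebra with a metric whose restriction to the center z is nondegenerate, let v = z^⊥, let j be the associated map, and assume j is injective; let h = Der(n) ∩ so(n, ⟨,⟩). Then an endomorphism B ∈ so(v, ⟨,⟩|_v) is the restriction to v of an element of h if and only if [B, j(z)] ⊆ j(z) and the map j⁻¹ ∘ ad_{so(v)}(B) ∘ j: z → z is skew-adjoint with respect to ⟨,⟩|_z. -/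
/-- **Lemma 3.1 (iii).**  For a finite-dimensional 2-step
nilpotent real metric Lie algebra `(n, B)` with nondegenerate center `z`,
`v = z^⊥` and injective associated map `j`, an endomorphism
`C ∈ so(v, B|_v)` extends to an element of `h = Der(n) ∩ so(n, B)` if and
only if `[C, j(z)] ⊆ j(z)` and `j⁻¹ ∘ ad_{so(v)}(C) ∘ j` is a skew-adjoint
map of `(z, B|_z)`; the latter two conditions are expressed by the existence
of a linear map `A : z → z`, skew-adjoint for `B|_z`, with
`j(Ax) = [C, j(x)]` for all `x ∈ z`. -/
theorem statement6 {n : Type} [LieRing n] [LieAlgebra ℝ n] [Module.Finite ℝ n]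
    (B : LinearMap.BilinForm ℝ n) (hsymm : B.IsSymm) (hnd : B.Nondegenerate)
    (h2a : ∃ x y : n, ⁅x, y⁆ ≠ 0) (h2b : ∀ x y w : n, ⁅⁅x, y⁆, w⁆ = 0)
    (z : Submodule ℝ n) (hz : ∀ x : n, x ∈ z ↔ ∀ y : n, ⁅x, y⁆ = 0)
    (hznd : (B.restrict z).Nondegenerate)
    (v : Submodule ℝ n) (hv : v = B.orthogonal z)
    (j : z →ₗ[ℝ] Module.End ℝ v)
    (hjdef : ∀ (x : z) (u w : v),
      B (j x u : n) (w : n) = B ⁅(u : n), (w : n)⁆ (x : n))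
    (hjinj : Function.Injective j)
    (C : Module.End ℝ v)
    (hCskew : ∀ u w : v, B (C u : n) (w : n) = - B (u : n) (C w : n)) :
    -- `C` extends to a skew-adjoint derivation of `n` ...
    (∃ D : Module.End ℝ n, (∀ a b : n, D ⁅a, b⁆ = ⁅D a, b⁆ + ⁅a, D b⁆) ∧
      (∀ a b : n, B (D a) b = - B a (D b)) ∧
      (∀ u : v, D (u : n) = (C u : n)))
    ↔
    -- ... iff `[C, j(z)] ⊆ j(z)` and `j⁻¹ ∘ ad(C) ∘ j ∈ so(z, B|_z)`:
    (∃ A : z →ₗ[ℝ] z,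
      (∀ x y : z, B (A x : n) (y : n) = - B (x : n) (A y : n)) ∧
      (∀ x : z, j (A x) = ⁅C, j x⁆)) := by
  have hsy : ∀ a b : n, B a b = B b a := fun a b => hsymm.eq a b
  have hc : IsCompl z v := by
    rw [hv]
    exact LinearMap.BilinForm.isCompl_orthogonal_of_restrict_nondegenerate hsymm.isRefl hznd
  have hzv : ∀ (x : z) (u : v), B (x : n) (u : n) = 0 := by
    intro x u
    have hu : (u : n) ∈ B.orthogonal z := hv ▸ u.2
    exact LinearMap.BilinForm.mem_orthogonal_iff.1 hu x x.2
  have hvz : ∀ (u : v) (x : z), B (u : n) (x : n) = 0 := by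
    intro u x
    rw [hsy, hzv]
  have hdec : ∀ a : n, ∃ (x : z) (u : v), a = x + u := by
    intro a
    have ha : a ∈ z ⊔ v := by rw [hc.sup_eq_top]; trivial
    obtain ⟨x, hx, u, hu, h⟩ := Submodule.mem_sup.1 ha
    exact ⟨⟨x, hx⟩, ⟨u, hu⟩, h.symm⟩
  have hvext : ∀ u u' : v, (∀ w : v, B (u : n) (w : n) = B (u' : n) (w : n)) → u = u' := by
    intro u u' h
    have h0 : ((u : n) - u') = 0 := by
      apply hnd.1
      intro a
      obtain ⟨x, w, rfl⟩ := hdec a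
      simp [hvz, h]
    exact Subtype.ext (sub_eq_zero.1 h0)
  have hzext : ∀ a a' : z, (∀ x : z, B (a : n) (x : n) = B (a' : n) (x : n)) → a = a' := by
    intro u u' h
    have h0 : ((u : n) - u') = 0 := by
      apply hnd.1
      intro a
      obtain ⟨x, w, rfl⟩ := hdec a
      simp [hzv, h]
    exact Subtype.ext (sub_eq_zero.1 h0)
  have hbr : ∀ a b : n, ⁅a, b⁆ ∈ z := fun a b => (hz _).2 (h2b a b)
  have hzl : ∀ (x : z) (b : n), ⁅(x : n), b⁆ = 0 := fun x => (hz _).1 x.2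
  have hzr : ∀ (b : n) (x : z), ⁅b, (x : n)⁆ = 0 := by
    intro b x
    rw [← lie_skew, hzl, neg_zero]
  constructor
  · rintro ⟨D, hD, hDs, hDC⟩
    have hDz : ∀ x ∈ z, D x ∈ z := by
      intro x hx
      rw [hz]
      intro b
      have h := hD x b
      rw [(hz x).1 hx, (hz x).1 hx, map_zero, add_zero] at h
      exact h.symm
    refine ⟨D.restrict hDz, fun x y => hDs x y, fun x => ?_⟩
    refine LinearMap.ext fun u => hvext _ _ fun w => ?_
    rw [hjdef]
    have e1 : B ⁅(u : n), (w : n)⁆ (D x) = - B (D ⁅(u : n), (w : n)⁆) x := by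
      rw [hDs, neg_neg]
    have e2 : ((⁅C, j x⁆ u : v) : n) = (C (j x u) : n) - (j x (C u) : n) := by
      simp [Ring.lie_def]
    rw [LinearMap.coe_restrict_apply, e1, e2, hD, hDC, hDC, map_add, LinearMap.add_apply,
      map_sub, LinearMap.sub_apply, hCskew, hjdef, hjdef]
    ring
  · rintro ⟨A, hA, hAj⟩
    have key : ∀ u w : v, (A ⟨⁅(u : n), (w : n)⁆, hbr _ _⟩ : n)
        = ⁅(C u : n), (w : n)⁆ + ⁅(u : n), (C w : n)⁆ := by
      intro u w
      have := hzext (A ⟨⁅(u : n), (w : n)⁆, hbr _ _⟩)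
        ⟨⁅(C u : n), (w : n)⁆ + ⁅(u : n), (C w : n)⁆, z.add_mem (hbr _ _) (hbr _ _)⟩ (by
          intro x
          have e2 : ((⁅C, j x⁆ u : v) : n) = (C (j x u) : n) - (j x (C u) : n) := by
            simp [Ring.lie_def]
          rw [hA]
          change - B ⁅(u : n), (w : n)⁆ (A x : n) = _
          rw [← hjdef, hAj, e2]
          simp only [map_add, map_sub, LinearMap.add_apply, LinearMap.sub_apply]
          rw [hCskew, hjdef, hjdef]
          ring)
      exact congrArg Subtype.val this
    obtain ⟨D, hDz, hDv⟩ : ∃ D : Module.End ℝ n, (∀ x : z, D x = A x) ∧ (∀ u : v, D u = C u) :=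
      ⟨LinearMap.ofIsCompl hc (z.subtype ∘ₗ A) (v.subtype ∘ₗ C), fun x => by simp, fun u => by simp⟩
    refine ⟨D, fun a b => ?_, fun a b => ?_, hDv⟩
    · obtain ⟨x, u, rfl⟩ := hdec a
      obtain ⟨y, w, rfl⟩ := hdec b
      have e := hDz ⟨⁅(u : n), (w : n)⁆, hbr _ _⟩
      rw [key] at e
      simp only [map_add, hDz, hDv, lie_add, add_lie, hzl, hzr, zero_add, add_zero, map_zero]
      simpa using e
    · obtain ⟨x, u, rfl⟩ := hdec a
      obtain ⟨y, w, rfl⟩ := hdec b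
      simp only [map_add, LinearMap.add_apply, hDz, hDv, hzv, hvz, hA x y, hCskew u w]
      ring
end

section
/- Let (n, ⟨,⟩) be a finite-dimensional 2-step nilpotent real Lie algebra with a metric whose restriction to the center z is nondegenerate, let v = z^⊥, let j be the associated map, and assume j is injective. Then (n, ⟨,⟩) is naturally reductive with respect to g = h ⋉ n if and only if: (i) j(z) is a Lie subalgebra of so(v, ⟨,⟩|_v), and (ii) for every x ∈ z there exists τ_x ∈ so(z, ⟨,⟩|_z) such that [j(x), j(y)] = j(τ_x y) for all y ∈ z. -/
/-- A metric Lie algebra `(n, B)` is *naturally reductive with respect to*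
`g = h ⋉ n`, where `h = Der(n) ∩ so(n, B)`, if there is a linear map
`π : n → h` such that `l = π(n)` is a Lie subalgebra of `h` with
`[l, m] ⊆ m` for `m = {x + π(x) : x ∈ n} ⊆ g` (this is the condition
`π(π(x)y) = [π(x), π(y)]`), and
`⟨[a,b]_m, c⟩ + ⟨b, [a,c]_m⟩ = 0` for all `a, b, c ∈ m`, where
`[x + π(x), y + π(y)]_m = w + π(w)` with `w = π(x)y − π(y)x + [x,y]` is the
projection onto `m` along `l` of the bracket of `g`, and the metric on `m` is
`⟨x + π(x), y + π(y)⟩ = B x y`. -/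
def IsNaturallyReductive (n : Type) [LieRing n] [LieAlgebra ℝ n]
    (B : LinearMap.BilinForm ℝ n) : Prop :=
  ∃ π : n →ₗ[ℝ] Module.End ℝ n,
    -- `π` takes values in `h = Der(n) ∩ so(n, B)`:
    (∀ x a b : n, π x ⁅a, b⁆ = ⁅π x a, b⁆ + ⁅a, π x b⁆) ∧
    (∀ x a b : n, B (π x a) b = - B a (π x b)) ∧
    -- `l = π(n)` is a Lie subalgebra of `h` and `[l, m] ⊆ m`:
    (∀ x y : n, ∃ w : n, ⁅π x, π y⁆ = π w) ∧
    (∀ x y : n, π (π x y) = ⁅π x, π y⁆) ∧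
    -- natural reductivity of the metric on `m ≅ n`:
    (∀ x y w : n,
      B (π x y - π y x + ⁅x, y⁆) w + B y (π x w - π w x + ⁅x, w⁆) = 0)

/-- **Theorem 3.2.**  Let `(n, B)` be a finite-dimensional
2-step nilpotent real metric Lie algebra with nondegenerate center `z`,
`v = z^⊥`, and injective associated map `j`.  Then `(n, B)` is naturally
reductive with respect to `g = h ⋉ n` (with `h = Der(n) ∩ so(n, B)`) if and
only if (i) `j(z)` is a Lie subalgebra of `so(v, B|_v)` and (ii) for every
`x ∈ z` there is `τ_x ∈ so(z, B|_z)` with `[j(x), j(y)] = j(τ_x y)` for all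
`y ∈ z`. -/
theorem statement7 {n : Type} [LieRing n] [LieAlgebra ℝ n] [Module.Finite ℝ n]
    (B : LinearMap.BilinForm ℝ n) (hsymm : B.IsSymm) (hnd : B.Nondegenerate)
    (h2a : ∃ x y : n, ⁅x, y⁆ ≠ 0) (h2b : ∀ x y w : n, ⁅⁅x, y⁆, w⁆ = 0)
    (z : Submodule ℝ n) (hz : ∀ x : n, x ∈ z ↔ ∀ y : n, ⁅x, y⁆ = 0)
    (hznd : (B.restrict z).Nondegenerate)
    (v : Submodule ℝ n) (hv : v = B.orthogonal z)
    (j : z →ₗ[ℝ] Module.End ℝ v)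
    (hjdef : ∀ (x : z) (u w : v),
      B (j x u : n) (w : n) = B ⁅(u : n), (w : n)⁆ (x : n))
    (hjinj : Function.Injective j) :
    IsNaturallyReductive n B ↔
      -- (i) `j(z)` is a Lie subalgebra of `so(v, B|_v)`:
      ((∀ x y : z, ∃ w : z, ⁅j x, j y⁆ = j w) ∧
      -- (ii) `[j(x), j(y)] = j(τ_x y)` with `τ_x ∈ so(z, B|_z)`:
       (∀ x : z, ∃ τ : z →ₗ[ℝ] z,
         (∀ a b : z, B (τ a : n) (b : n) = - B (a : n) (τ b : n)) ∧
         (∀ y : z, ⁅j x, j y⁆ = j (τ y)))) := by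
  have hs : ∀ a b, B a b = B b a := hsymm.eq
  have hc : IsCompl z v := by
    rw [hv]
    exact B.isCompl_orthogonal_of_restrict_nondegenerate hsymm.isRefl hznd
  have hzv : ∀ (a : z) (b : v), B (a : n) (b : n) = 0 := by
    intro a b
    have hb : (b : n) ∈ B.orthogonal z := hv ▸ b.2
    exact hb a a.2
  have hvz : ∀ (a : z) (b : v), B (b : n) (a : n) = 0 := fun a b => by rw [hs, hzv]
  have dec : ∀ a : n, ∃ p : z, ∃ q : v, a = p + q := by
    intro a
    have ha : a ∈ z ⊔ v := by rw [hc.sup_eq_top]; trivial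
    obtain ⟨p, hp, q, hq, h⟩ := Submodule.mem_sup.1 ha
    exact ⟨⟨p, hp⟩, ⟨q, hq⟩, h.symm⟩
  have nd : ∀ a : n, (∀ b, B a b = 0) → a = 0 := hnd.1
  have extz : ∀ a b : z, (∀ c : z, B (a : n) (c : n) = B (b : n) (c : n)) → a = b := by
    intro a b h
    apply Subtype.ext
    rw [← sub_eq_zero]
    apply nd
    intro c
    obtain ⟨p, q, rfl⟩ := dec c
    simp [hzv, h]
  have extv : ∀ a b : v, (∀ c : v, B (a : n) (c : n) = B (b : n) (c : n)) → a = b := by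
    intro a b h
    apply Subtype.ext
    rw [← sub_eq_zero]
    apply nd
    intro c
    obtain ⟨p, q, rfl⟩ := dec c
    simp [hvz, h]
  have cl : ∀ (a : z) (b : n), ⁅(a : n), b⁆ = 0 := fun a b => (hz a).1 a.2 b
  have cr : ∀ (a : z) (b : n), ⁅b, (a : n)⁆ = 0 := fun a b => by rw [← lie_skew, cl, neg_zero]
  constructor
  · rintro ⟨π, hder, hskew, -, hπ, hnat⟩
    have pz : ∀ (x : n) (a : z), π x a ∈ z := by
      intro x a
      rw [hz]
      intro y
      have := hder x a y
      rw [cl, cl, map_zero, add_zero] at this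
      exact this.symm
    have pv : ∀ (x : n) (a : v), π x a ∈ v := by
      intro x a
      suffices h : π x a ∈ B.orthogonal z from hv.symm ▸ h
      intro c hc'
      change B c (π x a) = 0
      have := hskew x c a
      rw [← neg_eq_iff_eq_neg] at this
      rw [← this, hzv ⟨_, pz x ⟨c, hc'⟩⟩ a, neg_zero]
    have pj : ∀ (w : z) (x : v), π (w : n) (x : n) = j w x := by
      intro w x
      have : (⟨_, pv w x⟩ : v) = j w x := by
        apply extv
        intro y
        have h1 := hnat x y w
        have h2 := hskew (x : n) y w
        have h3 := hvz w ⟨_, pv y x⟩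
        simp only [cr, map_add, map_sub, LinearMap.add_apply, LinearMap.sub_apply, map_zero] at h1
        simp only at h3
        rw [hjdef]
        simp only
        rw [hs]
        linarith
      exact congrArg Subtype.val this
    have key : ∀ x : z, ∃ τ : z →ₗ[ℝ] z,
         (∀ a b : z, B (τ a : n) (b : n) = - B (a : n) (τ b : n)) ∧
         (∀ y : z, ⁅j x, j y⁆ = j (τ y)) := by
      intro x
      refine ⟨(π (x : n)).restrict (fun a ha => pz x ⟨a, ha⟩), ?_, ?_⟩
      · intro a b
        exact hskew x a b
      · intro y
        ext u
        have h1 : π (π x y) u = ⁅π (x : n), π (y : n)⁆ (u : n) := by rw [hπ]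
        have h2 := pj ⟨_, pz x y⟩ u
        simp only at h2
        rw [h2] at h1
        rw [LieRing.of_associative_ring_bracket] at h1 ⊢
        simp only [LinearMap.sub_apply, Module.End.mul_apply, pj] at h1 ⊢
        push_cast
        exact h1.symm
    refine ⟨?_, key⟩
    intro x y
    obtain ⟨τ, -, h⟩ := key x
    exact ⟨τ y, h y⟩
  · rintro ⟨-, h⟩
    choose T₀ hTs hTj using h
    obtain ⟨T, hT⟩ : ∃ T : z →ₗ[ℝ] z →ₗ[ℝ] z, ∀ x y, T x y = T₀ x y := by
      refine ⟨LinearMap.mk₂ ℝ (fun x y => T₀ x y) ?_ ?_ ?_ ?_, fun _ _ => rfl⟩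
      · intro a b c
        apply hjinj
        rw [map_add, ← hTj, ← hTj, ← hTj, map_add]
        simp only [LieRing.of_associative_ring_bracket, add_mul, mul_add]
        abel
      · intro r a b
        apply hjinj
        rw [map_smul, ← hTj, ← hTj, map_smul]
        simp only [LieRing.of_associative_ring_bracket, smul_mul_assoc, mul_smul_comm, smul_sub]
      · intro a b c
        exact map_add _ _ _
      · intro r a b
        exact map_smul _ _ _
    replace hTs : ∀ x a b : z, B (T x a : n) (b : n) = - B (a : n) (T x b : n) := by
      intro x a b
      rw [hT, hT, hTs]
    replace hTj : ∀ x y : z, ⁅j x, j y⁆ = j (T x y) := by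
      intro x y
      rw [hT, hTj]
    have hTa : ∀ x y : z, T x y = - T y x := by
      intro x y
      apply hjinj
      rw [map_neg, ← hTj, ← hTj]
      simp only [LieRing.of_associative_ring_bracket, neg_sub]
    have hTl : ∀ x y w : z, T (T x y) w = T x (T y w) - T y (T x w) := by
      intro x y w
      apply hjinj
      simp only [map_sub, ← hTj]
      simp only [LieRing.of_associative_ring_bracket]
      simp only [sub_mul, mul_sub, mul_assoc]
      abel
    obtain ⟨br, hbr⟩ : ∃ br : v → v → z, ∀ p p' : z, ∀ q q' : v,
        ⁅(p + q : n), (p' + q' : n)⁆ = br q q' := by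
      refine ⟨fun q q' => ⟨⁅(q : n), (q' : n)⁆, (hz _).2 (h2b _ _)⟩, ?_⟩
      intro p p' q q'
      simp [cl, cr]
    have hj : ∀ (x : z) (u w : v), B (j x u : n) (w : n) = B (br u w : n) (x : n) := by
      intro x u w
      rw [hjdef, ← hbr 0 0]
      simp
    have bra : ∀ u w, br u w = - br w u := by
      intro u w
      apply Subtype.ext
      push_cast
      rw [← hbr 0 0, ← hbr 0 0, lie_skew]
    have hjs : ∀ (x : z) (u w : v), B (j x u : n) (w : n) = - B (u : n) (j x w : n) := by
      intro x u w
      rw [hs u, hj, hj, bra]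
      simp
    have hder : ∀ (x : z) (u w : v), T x (br u w) = br (j x u) w + br u (j x w) := by
      intro x u w
      apply extz
      intro c
      have e : j (T x c) u = j x (j c u) - j c (j x u) := by
        rw [← hTj, LieRing.of_associative_ring_bracket]; rfl
      push_cast
      rw [hTs, ← hj, e, map_add, LinearMap.add_apply, ← hj, ← hj]
      push_cast
      rw [map_sub, LinearMap.sub_apply, hjs x (j c u) w]
      ring
    obtain ⟨π, hp⟩ : ∃ π : n →ₗ[ℝ] Module.End ℝ n, ∀ (x a : z) (y b : v),
        π (x + y) (a + b) = T x a + j x b := by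
      let P := z.projectionOnto v hc
      let Q := v.projectionOnto z hc.symm
      refine ⟨LinearMap.mk₂ ℝ (fun x a => ((T (P x) (P a) : z) : n) + (j (P x) (Q a) : v))
        ?_ ?_ ?_ ?_, ?_⟩
      · intro a b c; simp; abel
      · intro a b c; simp
      · intro a b c; simp; abel
      · intro a b c; simp
      · intro x a y b
        simp [P, Q]
    have main : ∀ x y : n, π (π x y) = ⁅π x, π y⁆ := by
      intro x y
      apply LinearMap.ext
      intro a
      obtain ⟨x, x', rfl⟩ := dec x
      obtain ⟨y, y', rfl⟩ := dec y
      obtain ⟨a, a', rfl⟩ := dec a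
      rw [LieRing.of_associative_ring_bracket, LinearMap.sub_apply, Module.End.mul_apply,
        Module.End.mul_apply, hp, hp, hp, hp, hp, hp, hTl, ← hTj,
        LieRing.of_associative_ring_bracket]
      simp only [LinearMap.sub_apply, Module.End.mul_apply]
      push_cast
      abel
    refine ⟨π, ?_, ?_, fun x y => ⟨_, (main x y).symm⟩, main, ?_⟩
    · intro x a b
      obtain ⟨x, x', rfl⟩ := dec x
      obtain ⟨a, a', rfl⟩ := dec a
      obtain ⟨b, b', rfl⟩ := dec b
      rw [hbr, hp, hp, hbr, hbr]
      have := hp x (br a' b') x' 0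
      simp only [map_zero, ZeroMemClass.coe_zero, add_zero] at this
      rw [this, hder]
      rfl
    · intro x a b
      obtain ⟨x, x', rfl⟩ := dec x
      obtain ⟨a, a', rfl⟩ := dec a
      obtain ⟨b, b', rfl⟩ := dec b
      rw [hp, hp]
      simp only [map_add, LinearMap.add_apply, hzv, hvz, hTs x a b, hjs x a' b']
      ring
    · intro x y w
      obtain ⟨x, x', rfl⟩ := dec x
      obtain ⟨y, y', rfl⟩ := dec y
      obtain ⟨w, w', rfl⟩ := dec w
      rw [hp, hp, hp, hp, hbr, hbr]
      simp only [map_add, map_sub, LinearMap.add_apply, LinearMap.sub_apply, hzv, hvz]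
      have e1 := hTs x y w
      have e2 := hjs x y' w'
      have e3 := hj y x' w'
      have e4 := hj w x' y'
      have e5 : B (y : n) (T w x : n) = - B (y : n) (T x w : n) := by
        rw [hTa w x]; simp
      have e6 : B (T y x : n) (w : n) = - B (T x y : n) (w : n) := by
        rw [hTa y x]; simp
      have e7 := hs (j w x' : n) y'
      have e8 := hs (br x' w' : n) y
      linarith
end

section
/- Let (g, v, ⟨,⟩) be a data set and let (n, ⟨,⟩) be its associated 2-step nilpotent metric Lie algebra. Then (n, ⟨,⟩) is naturally reductive with respect to h ⋉ n, where h = Der(n) ∩ so(n, ⟨,⟩). Conversely, every 2-step nilpotent metric Lie algebra whose center is nondegenerate and whose associated map j is injective and which is naturally reductive with respect to h ⋉ n arises in this way from a data set. -/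
/-- **Theorem 3.4.**  (Forward direction)  Let `(g, v, ⟨,⟩)` be a
data set: `g` a finite-dimensional real Lie algebra with an ad-invariant
metric `Bg`, `(π, v)` a faithful representation of `g` without trivial
subrepresentations, and `Bv` a `π(g)`-invariant metric on `v`.  Let `N` be the
associated 2-step nilpotent Lie algebra: `N ≅ g ⊕ v` with the product metric,
`g` central, `[v, v] ⊆ g` and `⟨[u,w], x⟩_g = ⟨π(x)u, w⟩_v`.  Then `(N, B)` is
naturally reductive.  (Converse)  Every finite-dimensional 2-step nilpotent
real metric Lie algebra with nondegenerate center, injective associated map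
`j`, and naturally reductive metric arises in this way: the center carries a
Lie bracket `τ` for which the metric is ad-invariant and `j` is a faithful
representation without trivial subrepresentations under which the metric on
`v` is invariant. -/
theorem statement8 :
    -- forward direction:
    (∀ (g : Type) [LieRing g] [LieAlgebra ℝ g] [Module.Finite ℝ g]
       (v : Type) [AddCommGroup v] [Module ℝ v] [Module.Finite ℝ v]
       (Bg : LinearMap.BilinForm ℝ g) (Bv : LinearMap.BilinForm ℝ v)
       (π : g →ₗ[ℝ] Module.End ℝ v),
      Bg.IsSymm → Bg.Nondegenerate → Bv.IsSymm → Bv.Nondegenerate →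
      -- `Bg` is ad-invariant:
      (∀ x y w : g, Bg ⁅x, y⁆ w + Bg y ⁅x, w⁆ = 0) →
      -- `π` is a representation, faithful, without trivial subrepresentations:
      (∀ x y : g, π ⁅x, y⁆ = ⁅π x, π y⁆) →
      Function.Injective π →
      (∀ u : v, (∀ x : g, π x u = 0) → u = 0) →
      -- `Bv` is `π(g)`-invariant:
      (∀ (x : g) (u w : v), Bv (π x u) w = - Bv u (π x w)) →
      -- `(N, B)` is the associated 2-step nilpotent metric Lie algebra:
      ∀ (N : Type) [LieRing N] [LieAlgebra ℝ N] (e : N ≃ₗ[ℝ] g × v)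
        (B : LinearMap.BilinForm ℝ N),
        (∀ a b : N, B a b = Bg (e a).1 (e b).1 + Bv (e a).2 (e b).2) →
        (∀ a b : N, (e ⁅a, b⁆).2 = 0) →
        (∀ (a b : N) (x : g), Bg (e ⁅a, b⁆).1 x = Bv (π x (e a).2) (e b).2) →
        IsNaturallyReductive N B) ∧
    -- converse:
    (∀ (M : Type) [LieRing M] [LieAlgebra ℝ M] [Module.Finite ℝ M]
       (B : LinearMap.BilinForm ℝ M),
      B.IsSymm → B.Nondegenerate →
      (∃ x y : M, ⁅x, y⁆ ≠ 0) → (∀ x y w : M, ⁅⁅x, y⁆, w⁆ = 0) →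
      ∀ (z : Submodule ℝ M), (∀ x : M, x ∈ z ↔ ∀ y : M, ⁅x, y⁆ = 0) →
      (B.restrict z).Nondegenerate →
      ∀ (v : Submodule ℝ M), v = B.orthogonal z →
      ∀ (j : z →ₗ[ℝ] Module.End ℝ v),
      (∀ (x : z) (u w : v),
        B (j x u : M) (w : M) = B ⁅(u : M), (w : M)⁆ (x : M)) →
      Function.Injective j →
      IsNaturallyReductive M B →
      -- the center carries a Lie algebra structure `τ` making
      -- `(z, v, B)` a data set with representation `j`:
      ∃ τ : z →ₗ[ℝ] z →ₗ[ℝ] z,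
        (∀ x : z, τ x x = 0) ∧
        (∀ x y w : z, τ x (τ y w) = τ (τ x y) w + τ y (τ x w)) ∧
        -- `B|_z` is ad-invariant for `τ`:
        (∀ x y w : z, B (τ x y : M) (w : M) + B (y : M) (τ x w : M) = 0) ∧
        -- `j` is a representation of `(z, τ)` (automatically faithful, with
        -- `B|_v` invariant by the hypotheses above):
        (∀ x y : z, j (τ x y) = ⁅j x, j y⁆) ∧
        -- without trivial subrepresentations:
        (∀ u : v, (∀ x : z, j x u = 0) → u = 0)) := by
  refine ⟨?_, ?_⟩
  · intro g _ _ _ v _ _ _ Bg Bv π sg ng sv nv had hrep _ _ hinv N _ _ e B hB h2 h1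
    have hadj : ∀ x y w : g, Bg ⁅x, y⁆ w = - Bg y ⁅x, w⁆ := fun x y w => by
      linarith [had x y w]
    let F : N →ₗ[ℝ] N →ₗ[ℝ] N := LinearMap.mk₂ ℝ
      (fun a b => e.symm (⁅(e a).1, (e b).1⁆, π (e a).1 (e b).2))
      (by intro a a' b; rw [← map_add]; congr 1; ext <;> simp)
      (by intro c a b; rw [← map_smul]; congr 1; ext <;> simp)
      (by intro a a' b; rw [← map_add]; congr 1; ext <;> simp)
      (by intro c a b; rw [← map_smul]; congr 1; ext <;> simp)
    have F1 : ∀ a b, (e (F a b)).1 = ⁅(e a).1, (e b).1⁆ := fun a b => by simp [F]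
    have F2 : ∀ a b, (e (F a b)).2 = π (e a).1 (e b).2 := fun a b => by simp [F]
    have hext : ∀ a b : N, (e a).1 = (e b).1 → (e a).2 = (e b).2 → a = b := fun a b p q =>
      e.injective (Prod.ext p q)
    have hgext : ∀ p q : g, (∀ y, Bg p y = Bg q y) → p = q := by
      intro p q h
      rw [← sub_eq_zero]
      apply ng.1
      intro y
      simp [h y]
    have key : ∀ x y : N, F (F x y) = ⁅F x, F y⁆ := by
      intro x y
      ext w
      rw [Ring.lie_def, LinearMap.sub_apply, Module.End.mul_apply, Module.End.mul_apply]
      apply hext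
      · simp [F1]
      · simp [F2, F1, hrep, LieRing.of_associative_ring_bracket]
    refine ⟨F, ?_, ?_, ?_, key, ?_⟩
    · intro x a b
      apply hext
      · apply hgext
        intro y
        have r := congrArg (fun T => Bv (T (e a).2) (e b).2) (hrep (e x).1 y)
        simp [LieRing.of_associative_ring_bracket] at r
        rw [F1, hadj, h1, r, map_add, Prod.fst_add, map_add, LinearMap.add_apply, h1, h1, F2, F2,
          hinv (e x).1]
        ring
      · simp [F2, h2]
    · intro x a b
      rw [hB, hB, F1, F1, F2, F2, hadj, hinv]
      ring
    · intro x y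
      exact ⟨F x y, (key x y).symm⟩
    · intro x y w
      simp only [hB, map_add, map_sub, Prod.fst_add, Prod.fst_sub, Prod.snd_add, Prod.snd_sub,
        F1, F2, h2, LinearMap.add_apply, LinearMap.sub_apply, map_zero, LinearMap.zero_apply, h1]
      have a1 := sg.eq (e y).1 (e ⁅x, w⁆).1
      have a2 := h1 x w (e y).1
      have b1 := hadj (e x).1 (e y).1 (e w).1
      have b2 : Bg ⁅(e y).1, (e x).1⁆ (e w).1 = - Bg ⁅(e x).1, (e y).1⁆ (e w).1 := by
        rw [← lie_skew (e y).1 (e x).1]; simp only [map_neg, LinearMap.neg_apply]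
      have b3 : Bg (e y).1 ⁅(e w).1, (e x).1⁆ = - Bg (e y).1 ⁅(e x).1, (e w).1⁆ := by
        rw [← lie_skew (e w).1 (e x).1]; simp only [map_neg]
      have b4 := hinv (e x).1 (e y).2 (e w).2
      have b5 := sv.eq (e y).2 (π (e w).1 (e x).2)
      linarith
  · intro M _ _ _ B sB nB _ h2 z hz nz v hv j hj inj ⟨π, hder, hsk, _, hhom, hnr⟩
    have hs : ∀ a b, B a b = B b a := fun a b => sB.eq a b
    have hvm : ∀ u, u ∈ v ↔ ∀ x ∈ z, B x u = 0 := by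
      intro u; rw [hv]; exact Iff.rfl
    have pz : ∀ (a x : M), x ∈ z → π a x ∈ z := by
      intro a x hx
      rw [hz] at hx ⊢
      intro y
      have := hder a x y
      rw [hx, hx] at this
      simpa using this.symm
    have pv : ∀ (a u : M), u ∈ v → π a u ∈ v := by
      intro a u hu
      rw [hvm] at hu ⊢
      intro x hx
      have := hsk a x u
      rw [hu _ (pz a x hx)] at this
      linarith
    have hc : IsCompl z v := by
      rw [hv]
      exact LinearMap.BilinForm.isCompl_orthogonal_of_restrict_nondegenerate sB.isRefl nz
    have vext : ∀ a b : M, a ∈ v → b ∈ v → (∀ w ∈ v, B a w = B b w) → a = b := by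
      intro a b ha hb h
      rw [← sub_eq_zero]
      apply nB.1
      intro y
      have hy : y ∈ z ⊔ v := by rw [hc.sup_eq_top]; trivial
      obtain ⟨p, hp, q, hq, rfl⟩ := Submodule.mem_sup.1 hy
      have h3 := (hvm _).1 ha p hp
      have h4 := (hvm _).1 hb p hp
      rw [hs] at h3 h4
      simp [h3, h4, h q hq]
    have pj : ∀ (x : z) (u : v), (j x u : M) = π x u := by
      intro x u
      apply vext _ _ (j x u).2 (pv _ _ u.2)
      intro w hw
      rw [hj x u ⟨w, hw⟩]
      have h3 := hnr u w x
      have e1 := (hvm _).1 (pv u w hw) x x.2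
      have e2 := (hvm _).1 (pv w u u.2) x x.2
      have e3 := (hvm _).1 hw _ (pz u x x.2)
      have e4 : ⁅(u : M), (x : M)⁆ = 0 := by
        rw [← lie_skew, (hz _).1 x.2]; simp
      rw [hs] at e1 e2 e3
      simp only [map_add, map_sub, LinearMap.add_apply, LinearMap.sub_apply, e1, e2, e3, e4,
        map_zero] at h3
      have e5 := hs w (π x u)
      simp only
      linarith
    let τ : z →ₗ[ℝ] z →ₗ[ℝ] z := LinearMap.mk₂ ℝ
      (fun x y => ⟨π x y, pz x y y.2⟩)
      (by intro a a' b; ext; simp)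
      (by intro c a b; ext; simp)
      (by intro a a' b; ext; simp)
      (by intro c a b; ext; simp)
    have hτ : ∀ x y, (τ x y : M) = π x y := fun x y => rfl
    have hrep : ∀ x y : z, j (τ x y) = ⁅j x, j y⁆ := by
      intro x y
      ext u
      rw [pj, hτ, hhom]
      simp [LieRing.of_associative_ring_bracket, pj]
    refine ⟨τ, ?_, ?_, ?_, hrep, ?_⟩
    · intro x
      apply inj
      rw [hrep, Ring.lie_def]; simp
    · intro x y w
      apply inj
      rw [map_add]
      simp only [hrep, Ring.lie_def]
      simp only [mul_sub, sub_mul, mul_assoc]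
      abel
    · intro x y w
      rw [hτ, hτ, hsk]; ring
    · intro u hu
      have hcen : ∀ a b : M, ⁅a, b⁆ ∈ z := fun a b => (hz _).2 (h2 a b)
      have huv : ∀ w ∈ v, ⁅(u : M), w⁆ = 0 := by
        intro w hw
        have : (⟨⁅(u : M), w⁆, hcen _ _⟩ : z) = 0 := by
          apply nz.1
          intro x
          have := hj x u ⟨w, hw⟩
          rw [hu] at this
          simpa using this.symm
        exact congrArg Subtype.val this
      have huz : (u : M) ∈ z := by
        rw [hz]
        intro y
        have hy : y ∈ z ⊔ v := by rw [hc.sup_eq_top]; trivial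
        obtain ⟨p, hp, q, hq, rfl⟩ := Submodule.mem_sup.1 hy
        rw [lie_add, huv q hq, ← lie_skew, (hz _).1 hp]
        simp
      ext
      exact (Submodule.disjoint_def.1 hc.disjoint) _ huz u.2
end

section
/- Let (g, v, ⟨,⟩) be a data set and let n = g ⊕ v be its associated 2-step nilpotent metric Lie algebra. Then the center of n equals g, and the commutator ideal C(n) = [n, n] also equals g; in particular g is nondegenerate in n and v = g^⊥. -/
/-- Let `(g, v, ⟨,⟩)` be a data set (with `Bg` ad-invariant,
`π` faithful without trivial subrepresentations, `Bv` invariant) and let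
`N ≅ g ⊕ v` be the associated 2-step nilpotent metric Lie algebra.  Then the
center of `N` equals `g`, the commutator ideal `C(N) = [N, N]` equals `g`, the
metric is nondegenerate on `g`, and `v = g^⊥`. -/
theorem statement9
    (g : Type) [LieRing g] [LieAlgebra ℝ g] [Module.Finite ℝ g]
    (v : Type) [AddCommGroup v] [Module ℝ v] [Module.Finite ℝ v]
    (Bg : LinearMap.BilinForm ℝ g) (Bv : LinearMap.BilinForm ℝ v)
    (π : g →ₗ[ℝ] Module.End ℝ v)
    (hBgsymm : Bg.IsSymm) (hBgnd : Bg.Nondegenerate)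
    (hBvsymm : Bv.IsSymm) (hBvnd : Bv.Nondegenerate)
    (hadinv : ∀ x y w : g, Bg ⁅x, y⁆ w + Bg y ⁅x, w⁆ = 0)
    (hrep : ∀ x y : g, π ⁅x, y⁆ = ⁅π x, π y⁆)
    (hfaithful : Function.Injective π)
    (hnotriv : ∀ u : v, (∀ x : g, π x u = 0) → u = 0)
    (hBvinv : ∀ (x : g) (u w : v), Bv (π x u) w = - Bv u (π x w))
    -- `(N, B)` is the associated 2-step nilpotent metric Lie algebra:
    (N : Type) [LieRing N] [LieAlgebra ℝ N] (e : N ≃ₗ[ℝ] g × v)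
    (B : LinearMap.BilinForm ℝ N)
    (hB : ∀ a b : N, B a b = Bg (e a).1 (e b).1 + Bv (e a).2 (e b).2)
    (hbr1 : ∀ a b : N, (e ⁅a, b⁆).2 = 0)
    (hbr2 : ∀ (a b : N) (x : g), Bg (e ⁅a, b⁆).1 x = Bv (π x (e a).2) (e b).2) :
    -- the copy of `g` inside `N`:
    ∀ gsub : Submodule ℝ N,
      gsub = Submodule.comap (e : N →ₗ[ℝ] g × v)
        ((⊤ : Submodule ℝ g).prod (⊥ : Submodule ℝ v)) →
      -- the center of `N` equals `g`:
      (∀ a : N, (∀ b : N, ⁅a, b⁆ = 0) ↔ a ∈ gsub) ∧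
      -- the commutator ideal `C(N) = [N, N]` equals `g`:
      Submodule.span ℝ {w : N | ∃ a b : N, ⁅a, b⁆ = w} = gsub ∧
      -- `g` is nondegenerate in `N`:
      (B.restrict gsub).Nondegenerate ∧
      -- `v = g^⊥`:
      B.orthogonal gsub = Submodule.comap (e : N →ₗ[ℝ] g × v)
        ((⊥ : Submodule ℝ g).prod (⊤ : Submodule ℝ v)) := by
  intro gsub hg
  have mem : ∀ a : N, a ∈ gsub ↔ (e a).2 = 0 := by
    intro a; subst hg; simp [Submodule.mem_prod]
  have gz : ∀ x : g, (∀ y, Bg x y = 0) → x = 0 := hBgnd.1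
  have gz2 : ∀ x : g, (∀ y, Bg y x = 0) → x = 0 := hBgnd.2
  have vz : ∀ x : v, (∀ y, Bv x y = 0) → x = 0 := hBvnd.1
  refine ⟨?_, ?_, ?_, ?_⟩
  · intro a
    rw [mem]
    constructor
    · intro h
      apply hnotriv
      intro x
      apply vz
      intro w
      have := hbr2 a (e.symm (0, w)) x
      rw [h] at this
      simpa using this.symm
    · intro h b
      apply e.injective
      apply Prod.ext
      · rw [map_zero]
        apply gz
        intro x
        rw [hbr2, h]; simp
      · rw [hbr1]; simp
  · apply le_antisymm
    · rw [Submodule.span_le]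
      rintro w ⟨a, b, rfl⟩
      exact (mem _).2 (hbr1 a b)
    · set S := Submodule.span ℝ {w : N | ∃ a b : N, ⁅a, b⁆ = w} with hS
      have hSs : ∀ a b : N, ⁅a, b⁆ ∈ S := fun a b => Submodule.subset_span ⟨a, b, rfl⟩
      have hS2 : S ≤ gsub := by
        rw [hS, Submodule.span_le]
        rintro w ⟨a, b, rfl⟩
        exact (mem _).2 (hbr1 a b)
      let W : Submodule ℝ g := S.map ((LinearMap.fst ℝ g v) ∘ₗ (e : N →ₗ[ℝ] g × v))
      have hWo : Bg.orthogonal W = ⊥ := by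
        rw [eq_bot_iff]
        intro x hx
        rw [Submodule.mem_bot]
        apply hfaithful
        rw [map_zero]
        ext u
        apply vz
        intro w
        have h1 := hx (e ⁅e.symm (0, u), e.symm (0, w)⁆).1 ⟨_, hSs _ _, rfl⟩
        have h2 := hbr2 (e.symm (0, u)) (e.symm (0, w)) x
        have h3 : Bg (e ⁅e.symm (0, u), e.symm (0, w)⁆).1 x = 0 := h1
        rw [h3] at h2
        simpa using h2.symm
      have hW : W = ⊤ := by
        rw [← LinearMap.BilinForm.orthogonal_orthogonal hBgnd hBgsymm.isRefl W, hWo]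
        simp
      intro a ha
      have : (e a).1 ∈ W := by rw [hW]; trivial
      obtain ⟨s, hs, hse⟩ := this
      have : s = a := by
        apply e.injective
        apply Prod.ext
        · exact hse
        · rw [(mem _).1 ha, (mem _).1 (hS2 hs)]
      rwa [← this]
  · constructor
    · rintro ⟨a, ha⟩ h
      apply Subtype.ext
      apply e.injective
      apply Prod.ext
      · simp only [ZeroMemClass.coe_zero, map_zero, Prod.fst_zero]
        apply gz
        intro y
        have h1 : B a (e.symm (y, 0)) = 0 := h ⟨e.symm (y, 0), (mem _).2 (by simp)⟩
        rw [hB] at h1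
        simpa using h1
      · simpa using (mem _).1 ha
    · rintro ⟨a, ha⟩ h
      apply Subtype.ext
      apply e.injective
      apply Prod.ext
      · simp only [ZeroMemClass.coe_zero, map_zero, Prod.fst_zero]
        apply gz2
        intro y
        have h1 : B (e.symm (y, 0)) a = 0 := h ⟨e.symm (y, 0), (mem _).2 (by simp)⟩
        rw [hB] at h1
        simpa using h1
      · simpa using (mem _).1 ha
  · ext a
    have : a ∈ B.orthogonal gsub ↔ ∀ n ∈ gsub, B n a = 0 := Iff.rfl
    rw [this]
    simp only [Submodule.mem_comap, Submodule.mem_prod, Submodule.mem_bot, Submodule.mem_top,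
      and_true]
    constructor
    · intro h
      apply gz2
      intro y
      have h1 := h (e.symm (y, 0)) ((mem _).2 (by simp))
      rw [hB] at h1
      simpa using h1
    · intro h n hn
      have h' : (e a).1 = 0 := h
      rw [hB, (mem _).1 hn, h']
      simp
end

section
/- Let (g, v, ⟨,⟩) be a data set and let n = g ⊕ v be its associated 2-step nilpotent metric Lie algebra. Then the Lie algebra h = Der(n) ∩ so(n, ⟨,⟩) is isomorphic, via D ↦ (D|_g, D|_v), to {(A, B) ∈ (Der(g) ∩ so(g, ⟨,⟩_g)) × so(v, ⟨,⟩_v) : B π(x) − π(x) B = π(Ax) for all x ∈ g}. -/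
/-- **Proposition 3.8.**  Let `(g, v, ⟨,⟩)` be a data set and
`N ≅ g ⊕ v` the associated 2-step nilpotent metric Lie algebra.  Then
`h = Der(N) ∩ so(N, B)` is isomorphic, via `D ↦ (D|_g, D|_v)`, to
`{(A, C) ∈ (Der(g) ∩ so(g, Bg)) × so(v, Bv) : Cπ(x) − π(x)C = π(Ax) ∀x ∈ g}`. -/
theorem statement10
    (g : Type) [LieRing g] [LieAlgebra ℝ g] [Module.Finite ℝ g]
    (v : Type) [AddCommGroup v] [Module ℝ v] [Module.Finite ℝ v]
    (Bg : LinearMap.BilinForm ℝ g) (Bv : LinearMap.BilinForm ℝ v)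
    (π : g →ₗ[ℝ] Module.End ℝ v)
    (hBgsymm : Bg.IsSymm) (hBgnd : Bg.Nondegenerate)
    (hBvsymm : Bv.IsSymm) (hBvnd : Bv.Nondegenerate)
    (hadinv : ∀ x y w : g, Bg ⁅x, y⁆ w + Bg y ⁅x, w⁆ = 0)
    (hrep : ∀ x y : g, π ⁅x, y⁆ = ⁅π x, π y⁆)
    (hfaithful : Function.Injective π)
    (hnotriv : ∀ u : v, (∀ x : g, π x u = 0) → u = 0)
    (hBvinv : ∀ (x : g) (u w : v), Bv (π x u) w = - Bv u (π x w))
    (N : Type) [LieRing N] [LieAlgebra ℝ N] (e : N ≃ₗ[ℝ] g × v)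
    (B : LinearMap.BilinForm ℝ N)
    (hB : ∀ a b : N, B a b = Bg (e a).1 (e b).1 + Bv (e a).2 (e b).2)
    (hbr1 : ∀ a b : N, (e ⁅a, b⁆).2 = 0)
    (hbr2 : ∀ (a b : N) (x : g), Bg (e ⁅a, b⁆).1 x = Bv (π x (e a).2) (e b).2) :
    -- every `D ∈ h` decomposes as a pair `(A, C)` with `A` a skew-adjoint
    -- derivation of `g`, `C ∈ so(v, Bv)` and `Cπ(x) − π(x)C = π(Ax)`:
    (∀ D : Module.End ℝ N, (∀ a b : N, D ⁅a, b⁆ = ⁅D a, b⁆ + ⁅a, D b⁆) →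
      (∀ a b : N, B (D a) b = - B a (D b)) →
      ∃ (A : Module.End ℝ g) (C : Module.End ℝ v),
        (∀ a : N, e (D a) = (A (e a).1, C (e a).2)) ∧
        (∀ x y : g, A ⁅x, y⁆ = ⁅A x, y⁆ + ⁅x, A y⁆) ∧
        (∀ x y : g, Bg (A x) y = - Bg x (A y)) ∧
        (∀ u w : v, Bv (C u) w = - Bv u (C w)) ∧
        (∀ x : g, C * π x - π x * C = π (A x))) ∧
    -- conversely, every such pair `(A, C)` arises from an element of `h`:
    (∀ (A : Module.End ℝ g) (C : Module.End ℝ v),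
      (∀ x y : g, A ⁅x, y⁆ = ⁅A x, y⁆ + ⁅x, A y⁆) →
      (∀ x y : g, Bg (A x) y = - Bg x (A y)) →
      (∀ u w : v, Bv (C u) w = - Bv u (C w)) →
      (∀ x : g, C * π x - π x * C = π (A x)) →
      ∃ D : Module.End ℝ N, (∀ a b : N, D ⁅a, b⁆ = ⁅D a, b⁆ + ⁅a, D b⁆) ∧
        (∀ a b : N, B (D a) b = - B a (D b)) ∧
        (∀ a : N, e (D a) = (A (e a).1, C (e a).2))) := by
  have hg0 : ∀ x : g, (∀ y, Bg x y = 0) → x = 0 := hBgnd.1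
  have hv0 : ∀ x : v, (∀ y, Bv x y = 0) → x = 0 := hBvnd.1
  have hg1 : ∀ x x' : g, (∀ y, Bg x y = Bg x' y) → x = x' := fun x x' h =>
    sub_eq_zero.1 (hg0 _ fun y => by simp [h y])
  have hv1 : ∀ x x' : v, (∀ y, Bv x y = Bv x' y) → x = x' := fun x x' h =>
    sub_eq_zero.1 (hv0 _ fun y => by simp [h y])
  constructor
  · intro D hD hS
    -- `D` preserves `g`
    have h1 : ∀ x : g, (e (D (e.symm (x, 0)))).2 = 0 := by
      intro x
      apply hnotriv
      intro y
      apply hv0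
      intro w
      have hz : ∀ b : N, ⁅e.symm (x, (0 : v)), b⁆ = 0 := by
        intro b
        apply e.injective
        rw [map_zero]
        refine Prod.ext (hg0 _ fun y => ?_) (hbr1 _ _)
        rw [hbr2]; simp
      have hd := hD (e.symm (x, 0)) (e.symm (0, w))
      rw [hz, hz, map_zero, add_zero] at hd
      have := hbr2 (D (e.symm (x, 0))) (e.symm (0, w)) y
      rw [← hd] at this
      simpa using this.symm
    have h2 : ∀ u : v, (e (D (e.symm (0, u)))).1 = 0 := by
      intro u
      apply hg0
      intro x
      have := hS (e.symm (0, u)) (e.symm (x, 0))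
      rw [hB, hB] at this
      simpa [h1] using this
    let A : Module.End ℝ g := LinearMap.fst ℝ g v ∘ₗ e.toLinearMap ∘ₗ D ∘ₗ
      e.symm.toLinearMap ∘ₗ LinearMap.inl ℝ g v
    let C : Module.End ℝ v := LinearMap.snd ℝ g v ∘ₗ e.toLinearMap ∘ₗ D ∘ₗ
      e.symm.toLinearMap ∘ₗ LinearMap.inr ℝ g v
    have hA : ∀ x, A x = (e (D (e.symm (x, 0)))).1 := fun x => rfl
    have hC : ∀ u, C u = (e (D (e.symm (0, u)))).2 := fun x => rfl
    have hdec : ∀ a : N, e (D a) = (A (e a).1, C (e a).2) := by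
      intro a
      have ha : a = e.symm ((e a).1, 0) + e.symm (0, (e a).2) := by
        rw [← map_add]; simp
      conv_lhs => rw [ha, map_add, map_add]
      apply Prod.ext
      · rw [Prod.fst_add, h2, add_zero, hA]
      · rw [Prod.snd_add, h1, zero_add, hC]
    clear_value A C
    have hAs : ∀ x y : g, Bg (A x) y = - Bg x (A y) := by
      intro x y
      have := hS (e.symm (x, 0)) (e.symm (y, 0))
      rw [hB, hB, hdec, hdec] at this
      simpa using this
    have hCs : ∀ u w : v, Bv (C u) w = - Bv u (C w) := by
      intro x y
      have := hS (e.symm (0, x)) (e.symm (0, y))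
      rw [hB, hB, hdec, hdec] at this
      simpa using this
    have hcomm : ∀ x : g, C * π x - π x * C = π (A x) := by
      intro x
      ext u
      apply hv1
      intro w
      have h := congrArg (fun n => Bg (e n).1 x) (hD (e.symm (0, u)) (e.symm (0, w)))
      simp only [map_add, Prod.fst_add, LinearMap.add_apply, hbr2] at h
      rw [hdec, hdec, hdec] at h
      simp only [LinearEquiv.apply_symm_apply] at h
      rw [hAs, hbr2] at h
      simp only [LinearEquiv.apply_symm_apply] at h
      simp only [LinearMap.sub_apply, Module.End.mul_apply, map_sub]
      rw [hCs]
      linarith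
    refine ⟨A, C, hdec, ?_, hAs, hCs, hcomm⟩
    intro x y
    apply hfaithful
    rw [map_add, hrep, hrep, ← hcomm, ← hcomm, ← hcomm, hrep]
    simp only [Ring.lie_def]
    noncomm_ring
  · intro A C hAd hAs hCs hcomm
    let D : Module.End ℝ N := e.symm.toLinearMap ∘ₗ (LinearMap.prodMap A C) ∘ₗ e.toLinearMap
    have hdec : ∀ a : N, e (D a) = (A (e a).1, C (e a).2) := by
      intro a
      simp [D]
    clear_value D
    refine ⟨D, ?_, ?_, hdec⟩
    · intro a b
      apply e.injective
      apply Prod.ext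
      · apply hg1
        intro x
        rw [hdec, map_add, Prod.fst_add, map_add, LinearMap.add_apply, hbr2, hbr2, hdec, hdec]
        simp only
        rw [hAs, hbr2, ← hcomm]
        simp only [LinearMap.sub_apply, Module.End.mul_apply, map_sub]
        rw [hCs]
        ring
      · rw [hdec, map_add, Prod.snd_add, hbr1, hbr1, hbr1]
        simp
    · intro a b
      rw [hB, hB, hdec, hdec]
      simp only
      rw [hAs, hCs]
      ring
end

section
/- Let (g, v, ⟨,⟩) be a data set with g semisimple, let n = g ⊕ v be the associated 2-step nilpotent metric Lie algebra, and let h = Der(n) ∩ so(n, ⟨,⟩), identified with {(A, B) ∈ (Der(g) ∩ so(g, ⟨,⟩_g)) × so(v, ⟨,⟩_v) : [B, π(x)] = π(Ax) for all x ∈ g}. Then h decomposes as a direct sum of Lie algebras h = g' ⊕ e_g, where g' = {(ad(x), π(x)) : x ∈ g} is a subalgebra isomorphic to g and e_g = {(0, B') : B' ∈ End_g(v) ∩ so(v, ⟨,⟩_v)}, End_g(v) being the algebra of endomorphisms of v commuting with π(x) for all x ∈ g; moreover g' and e_g commute. -/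
/-- **Corollary 3.9, infinitesimal version.**  Let
`(g, v, ⟨,⟩)` be a data set with `g` semisimple and `N ≅ g ⊕ v` the associated
2-step nilpotent metric Lie algebra, and identify `h = Der(N) ∩ so(N, B)` with
`{(A, C) ∈ (Der(g) ∩ so(g, Bg)) × so(v, Bv) : [C, π(x)] = π(Ax) ∀x}`.  Then
`h = g' ⊕ e_g`, where `g' = {(ad x, π x) : x ∈ g} ≅ g` and
`e_g = End_g(v) ∩ so(v, Bv)`; the summands commute, the map
`x ↦ (ad x, π x)` is injective, and the decomposition is unique. -/
theorem statement11
    (g : Type) [LieRing g] [LieAlgebra ℝ g] [Module.Finite ℝ g]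
    [LieAlgebra.IsSemisimple ℝ g]
    (v : Type) [AddCommGroup v] [Module ℝ v] [Module.Finite ℝ v]
    (Bg : LinearMap.BilinForm ℝ g) (Bv : LinearMap.BilinForm ℝ v)
    (π : g →ₗ[ℝ] Module.End ℝ v)
    (hBgsymm : Bg.IsSymm) (hBgnd : Bg.Nondegenerate)
    (hBvsymm : Bv.IsSymm) (hBvnd : Bv.Nondegenerate)
    (hadinv : ∀ x y w : g, Bg ⁅x, y⁆ w + Bg y ⁅x, w⁆ = 0)
    (hrep : ∀ x y : g, π ⁅x, y⁆ = ⁅π x, π y⁆)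
    (hfaithful : Function.Injective π)
    (hnotriv : ∀ u : v, (∀ x : g, π x u = 0) → u = 0)
    (hBvinv : ∀ (x : g) (u w : v), Bv (π x u) w = - Bv u (π x w)) :
    -- the embedding `x ↦ (ad x, π x)` of `g` into `h` is injective (a Lie
    -- algebra isomorphism onto `g'`, since `ad` and `π` are Lie homomorphisms):
    Function.Injective
      (fun x : g => ((LieAlgebra.ad ℝ g x, π x) : Module.End ℝ g × Module.End ℝ v)) ∧
    -- `g'` and `e_g` commute:
    (∀ (x : g) (C' : Module.End ℝ v), (∀ y : g, C' * π y = π y * C') →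
      ⁅π x, C'⁆ = 0) ∧
    -- every `(A, C) ∈ h` decomposes uniquely as `(ad x, π x) + (0, C')` with
    -- `C' ∈ e_g = End_g(v) ∩ so(v, Bv)`:
    (∀ (A : Module.End ℝ g) (C : Module.End ℝ v),
      (∀ x y : g, A ⁅x, y⁆ = ⁅A x, y⁆ + ⁅x, A y⁆) →
      (∀ x y : g, Bg (A x) y = - Bg x (A y)) →
      (∀ u w : v, Bv (C u) w = - Bv u (C w)) →
      (∀ x : g, ⁅C, π x⁆ = π (A x)) →
      ∃ (x : g) (C' : Module.End ℝ v),
        (∀ y : g, A y = ⁅x, y⁆) ∧ C = π x + C' ∧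
        (∀ y : g, C' * π y = π y * C') ∧
        (∀ u w : v, Bv (C' u) w = - Bv u (C' w)) ∧
        (∀ (x₂ : g) (C'₂ : Module.End ℝ v),
          (∀ y : g, A y = ⁅x₂, y⁆) → C = π x₂ + C'₂ →
          (∀ y : g, C'₂ * π y = π y * C'₂) →
          x₂ = x ∧ C'₂ = C')) := by
  refine ⟨fun x y h => hfaithful (congrArg Prod.snd h), ?_, ?_⟩
  · intro x C' h
    rw [Ring.lie_def, h x, sub_self]
  · intro A C hA _ hC hAC
    let D : LieDerivation ℝ g g :=
      { toLinearMap := A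
        leibniz' := by
          intro a b
          rw [hA, ← lie_skew (A a) b]
          abel }
    obtain ⟨x, hx⟩ := LieDerivation.IsKilling.exists_eq_ad D
    have hx' : ∀ y : g, A y = ⁅x, y⁆ := by
      intro y
      have h : D y = ⁅x, y⁆ := by rw [← hx]; simp
      exact h
    refine ⟨x, C - π x, hx', by abel, ?_, ?_, ?_⟩
    · intro y
      have h := hAC y
      rw [hx', hrep, Ring.lie_def, Ring.lie_def] at h
      rw [sub_mul, mul_sub, sub_eq_sub_iff_sub_eq_sub]
      exact h
    · intro u w
      simp only [LinearMap.sub_apply, map_sub, hC, hBvinv]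
      ring
    · intro x₂ C₂ h1 h2 _
      have hxx : x₂ = x := by
        apply LieDerivation.injective_ad_of_center_eq_bot (R := ℝ) (L := g) (by simp)
        ext y
        simp [← h1, ← hx']
      subst hxx
      refine ⟨rfl, ?_⟩
      rw [h2]
      abel
end

section
/- Let (n, ⟨,⟩) be a finite-dimensional 2-step nilpotent real Lie algebra with a metric whose restriction to the center z is nondegenerate, let v = z^⊥, let j be the associated map, and let R be the curvature of the Levi-Civita product. Let x, y ∈ n span a nondegenerate plane with ⟨x, y⟩ = 0, ⟨x, x⟩ = ε₁ ∈ {±1} and ⟨y, y⟩ = ε₂ ∈ {±1}, and set K(x, y) = ⟨R(x, y)y, x⟩ / (⟨x, x⟩⟨y, y⟩ − ⟨x, y⟩²). Then K(x, y) = −(3ε₁ε₂/4)⟨[x, y], [x, y]⟩ if x, y ∈ v; K(x, y) = (ε₁ε₂/4)⟨j(y)x, j(y)x⟩ if x ∈ v and y ∈ z; and K(x, y) = 0 if x, y ∈ z. -/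
/-- **formula (15).**  Sectional curvature of a 2-step
nilpotent metric Lie algebra with nondegenerate center: for an orthonormal
pair `x, y` spanning a nondegenerate plane, with
`K(x,y) = ⟨R(x,y)y, x⟩ / (⟨x,x⟩⟨y,y⟩ − ⟨x,y⟩²)`:
`K(x,y) = −(3ε₁ε₂/4)⟨[x,y],[x,y]⟩` if `x, y ∈ v`;
`K(x,y) = (ε₁ε₂/4)⟨j(y)x, j(y)x⟩` if `x ∈ v`, `y ∈ z`;  and
`K(x,y) = 0` if `x, y ∈ z`. -/
theorem statement14 {n : Type} [LieRing n] [LieAlgebra ℝ n] [Module.Finite ℝ n]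
    (B : LinearMap.BilinForm ℝ n) (hsymm : B.IsSymm) (hnd : B.Nondegenerate)
    (h2a : ∃ x y : n, ⁅x, y⁆ ≠ 0) (h2b : ∀ x y w : n, ⁅⁅x, y⁆, w⁆ = 0)
    (z : Submodule ℝ n) (hz : ∀ x : n, x ∈ z ↔ ∀ y : n, ⁅x, y⁆ = 0)
    (hznd : (B.restrict z).Nondegenerate)
    (v : Submodule ℝ n) (hv : v = B.orthogonal z)
    (j : z →ₗ[ℝ] Module.End ℝ v)
    (hjdef : ∀ (x : z) (u w : v),
      B (j x u : n) (w : n) = B ⁅(u : n), (w : n)⁆ (x : n))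
    -- `nab` is the Levi-Civita product of `(n, B)`:
    (nab : n →ₗ[ℝ] n →ₗ[ℝ] n)
    (hnab : ∀ x y w : n,
      B (nab x y) w = (B ⁅x, y⁆ w - B y ⁅x, w⁆ - B x ⁅y, w⁆) / 2)
    -- `R` is the curvature tensor of `∇`:
    (R : n → n → n → n)
    (hR : ∀ x y w : n,
      R x y w = nab x (nab y w) - nab y (nab x w) - nab ⁅x, y⁆ w)
    -- `K` is the sectional curvature:
    (K : n → n → ℝ)
    (hK : ∀ x y : n, K x y = B (R x y y) x / (B x x * B y y - (B x y) ^ 2)) :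
    -- `x, y ∈ v` orthonormal:
    (∀ x y : v, ∀ ε₁ ε₂ : ℝ, (ε₁ = 1 ∨ ε₁ = -1) → (ε₂ = 1 ∨ ε₂ = -1) →
      B (x : n) (x : n) = ε₁ → B (y : n) (y : n) = ε₂ → B (x : n) (y : n) = 0 →
      K (x : n) (y : n) = -(3 * ε₁ * ε₂ / 4) * B ⁅(x : n), (y : n)⁆ ⁅(x : n), (y : n)⁆) ∧
    -- `x ∈ v`, `y ∈ z` orthonormal:
    (∀ (x : v) (y : z), ∀ ε₁ ε₂ : ℝ, (ε₁ = 1 ∨ ε₁ = -1) → (ε₂ = 1 ∨ ε₂ = -1) →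
      B (x : n) (x : n) = ε₁ → B (y : n) (y : n) = ε₂ → B (x : n) (y : n) = 0 →
      K (x : n) (y : n) = (ε₁ * ε₂ / 4) * B (j y x : n) (j y x : n)) ∧
    -- `x, y ∈ z` orthonormal:
    (∀ x y : z, ∀ ε₁ ε₂ : ℝ, (ε₁ = 1 ∨ ε₁ = -1) → (ε₂ = 1 ∨ ε₂ = -1) →
      B (x : n) (x : n) = ε₁ → B (y : n) (y : n) = ε₂ → B (x : n) (y : n) = 0 →
      K (x : n) (y : n) = 0) := by
  have hs : ∀ a b : n, B a b = B b a := fun a b => hsymm.eq a b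
  have hext : ∀ a b : n, (∀ w, B a w = B b w) → a = b := by
    intro a b h
    have h0 : a - b = 0 := hnd.1 (a - b) (fun w => by simp [h w])
    exact sub_eq_zero.mp h0
  have hskewL : ∀ a b : n, ⁅a, b⁆ = -⁅b, a⁆ := fun a b => (lie_skew a b).symm
  have hzr : ∀ x ∈ z, ∀ y : n, ⁅y, x⁆ = 0 := by
    intro x hx y
    rw [hskewL, (hz x).1 hx y, neg_zero]
  have hbr : ∀ x y : n, ⁅x, y⁆ ∈ z := fun x y => (hz _).2 (h2b x y)
  have hzv : ∀ a ∈ z, ∀ b ∈ v, B a b = 0 := by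
    intro a ha b hb
    rw [hv] at hb
    exact hb a ha
  have hskew : ∀ x y w : n, B (nab x y) w = - B y (nab x w) := by
    intro x y w
    rw [hs y, hnab, hnab, hs ⁅x, y⁆ w, hs ⁅x, w⁆ y, hskewL w y, map_neg]
    ring
  have hBR : ∀ x y : n, B (R x y y) x =
      - B (nab y y) (nab x x) + B (nab x y) (nab y x) - B (nab ⁅x, y⁆ y) x := by
    intro x y
    rw [hR]
    simp only [map_sub, LinearMap.sub_apply]
    rw [hskew x (nab y y) x, hskew y (nab x y) x]
    ring
  have hvv : ∀ x ∈ v, ∀ y ∈ v, nab x y = (1 / 2 : ℝ) • ⁅x, y⁆ := by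
    intro x hx y hy
    apply hext
    intro w
    rw [hnab, hs y, hs x, hzv _ (hbr x w) y hy, hzv _ (hbr y w) x hx]
    simp only [map_smul, LinearMap.smul_apply, smul_eq_mul]
    ring
  have hzz : ∀ x ∈ z, ∀ y ∈ z, nab x y = 0 := by
    intro x hx y hy
    apply hext
    intro w
    rw [hnab, (hz x).1 hx, (hz x).1 hx, (hz y).1 hy]
    simp
  have hdiv : ∀ (x y : n) (e₁ e₂ c : ℝ), (e₁ = 1 ∨ e₁ = -1) → (e₂ = 1 ∨ e₂ = -1) →
      B x x = e₁ → B y y = e₂ → B x y = 0 → B (R x y y) x = c →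
      K x y = e₁ * e₂ * c := by
    intro x y e₁ e₂ c h1 h2 hx hy hxy hc
    rw [hK, hc, hx, hy, hxy]
    rcases h1 with rfl | rfl <;> rcases h2 with rfl | rfl <;> ring
  refine ⟨?_, ?_, ?_⟩
  · intro x y e₁ e₂ h1 h2 hx hy hxy
    have key : B (R (x : n) y y) x = -(3 / 4) * B ⁅(x : n), (y : n)⁆ ⁅(x : n), (y : n)⁆ := by
      rw [hBR, hvv _ x.2 _ y.2, hvv _ y.2 _ x.2, hvv _ x.2 _ x.2, hvv _ y.2 _ y.2, hnab ⁅(x : n), (y : n)⁆, h2b, h2b,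
        hskewL (y : n) x]
      simp only [map_smul, LinearMap.smul_apply, smul_eq_mul, lie_self, map_neg, map_zero,
        LinearMap.zero_apply, smul_neg]
      ring
    rw [hdiv _ _ e₁ e₂ _ h1 h2 hx hy hxy key]
    ring
  · intro x y e₁ e₂ h1 h2 hx hy hxy
    have hyx : nab (y : n) x = nab (x : n) y := by
      apply hext
      intro w
      rw [hnab, hnab, (hz y).1 y.2, (hz y).1 y.2, hzr _ y.2]
      ring
    have hp : ∀ w : n, B (nab (x : n) y) w = -(1 / 2) * B ⁅(x : n), w⁆ y := by
      intro w
      rw [hnab, hzr _ y.2, (hz y).1 y.2, hs y]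
      simp only [map_zero, LinearMap.zero_apply]
      ring
    have hpv : nab (x : n) y ∈ v := by
      refine (congrArg (fun S : Submodule ℝ n => nab (x : n) y ∈ S) hv).mpr ?_
      intro a ha
      change B a _ = 0
      rw [hs, hp, hzr a ha]
      simp
    have e1 := hp (nab (x : n) y)
    have e2 := hp (j y x)
    have e3 := hjdef y x ⟨_, hpv⟩
    have e4 := hjdef y x (j y x)
    have e5 := hs (nab (x : n) y) (j y x)
    simp only at e3
    have key : B (R (x : n) y y) x = 1 / 4 * B (j y x : n) (j y x : n) := by
      rw [hBR, hyx, hzz _ y.2 _ y.2, hzr _ y.2]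
      simp only [map_zero, LinearMap.zero_apply]
      linarith
    rw [hdiv _ _ e₁ e₂ _ h1 h2 hx hy hxy key]
    ring
  · intro x y e₁ e₂ h1 h2 hx hy hxy
    have key : B (R (x : n) y y) x = 0 := by
      rw [hBR, hzz _ y.2 _ y.2, hzz _ x.2 _ y.2, hzr _ y.2]
      simp
    rw [hdiv _ _ e₁ e₂ _ h1 h2 hx hy hxy key]
    ring
end

section
/- Let (n, ⟨,⟩) be a finite-dimensional 2-step nilpotent real Lie algebra with a metric whose restriction to the center z is nondegenerate, let v = z^⊥, let j be the associated map, and define the Ricci tensor Ric(x, y) = trace(w ↦ R(w, x)y) using the curvature R of the Levi-Civita product. Let {z_i} be an orthonormal basis of z with ε_i = ⟨z_i, z_i⟩ and {v_j} an orthonormal basis of v with ε̄_j = ⟨v_j, v_j⟩. Then: Ric(x, y) = 0 for x ∈ v and y ∈ z; Ric(x, y) = ½ Σ_i ε_i ⟨j(z_i)² x, y⟩ for x, y ∈ v; and Ric(x, y) = −¼ Σ_j ε̄_j ⟨j(x) j(y) v_j, v_j⟩ for x, y ∈ z. -/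
open LinearMap in
lemma orth_expand {n : Type} [AddCommGroup n] [Module ℝ n]
    (B : LinearMap.BilinForm ℝ n) {α : Type} [Fintype α] [DecidableEq α] (e : α → n) (s : α → ℝ)
    (hs : ∀ a, s a = 1 ∨ s a = -1)
    (hob : ∀ a b, B (e a) (e b) = if a = b then s a else 0)
    (x : n) (hx : x ∈ Submodule.span ℝ (Set.range e)) :
    x = ∑ a, (s a * B x (e a)) • e a := by
  induction hx using Submodule.span_induction with
  | mem x h =>
    obtain ⟨b, rfl⟩ := h
    have h1 : s b * s b = 1 := by rcases hs b with h | h <;> rw [h] <;> norm_num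
    rw [Finset.sum_eq_single b]
    · simp [hob, h1]
    · intro a _ hab
      simp [hob, hab.symm]
    · simp
  | zero => simp
  | add x y _ _ hx hy =>
    conv_lhs => rw [hx, hy]
    simp [mul_add, add_smul, Finset.sum_add_distrib]
  | smul c x _ hx =>
    conv_lhs => rw [hx]
    simp only [Finset.smul_sum, smul_smul, map_smul, LinearMap.smul_apply, smul_eq_mul]
    refine Finset.sum_congr rfl fun a _ => ?_
    congr 1
    ring

lemma orth_parseval {n : Type} [AddCommGroup n] [Module ℝ n]
    (B : LinearMap.BilinForm ℝ n) (hsymm : ∀ x y, B x y = B y x)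
    {α : Type} [Fintype α] [DecidableEq α] (e : α → n) (s : α → ℝ)
    (hs : ∀ a, s a = 1 ∨ s a = -1)
    (hob : ∀ a b, B (e a) (e b) = if a = b then s a else 0)
    (x y : n) (hx : x ∈ Submodule.span ℝ (Set.range e)) :
    B x y = ∑ a, s a * (B x (e a) * B y (e a)) := by
  conv_lhs => rw [orth_expand B e s hs hob x hx]
  simp only [map_sum, map_smul, LinearMap.sum_apply, LinearMap.smul_apply, smul_eq_mul]
  refine Finset.sum_congr rfl fun a _ => ?_
  rw [hsymm (e a) y]
  ring

lemma orth_trace {n : Type} [AddCommGroup n] [Module ℝ n]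
    (B : LinearMap.BilinForm ℝ n)
    {α : Type} [Fintype α] [DecidableEq α] (e : α → n) (s : α → ℝ)
    (hs : ∀ a, s a = 1 ∨ s a = -1)
    (hob : ∀ a b, B (e a) (e b) = if a = b then s a else 0)
    (hspan : ⊤ ≤ Submodule.span ℝ (Set.range e)) (T : Module.End ℝ n) :
    LinearMap.trace ℝ n T = ∑ a, s a * B (T (e a)) (e a) := by
  have hli : LinearIndependent ℝ e := by
    rw [Fintype.linearIndependent_iff]
    intro g hg b
    have h := congrArg (fun t => B t (e b)) hg
    simp only [map_sum, map_smul, LinearMap.sum_apply, LinearMap.smul_apply, smul_eq_mul,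
      hob, map_zero, LinearMap.zero_apply, mul_ite, mul_zero, Finset.sum_ite_eq',
      Finset.mem_univ, if_true] at h
    rcases hs b with h' | h' <;> rw [h'] at h <;> linarith
  let b := Module.Basis.mk hli hspan
  rw [LinearMap.trace_eq_matrix_trace ℝ b, Matrix.trace]
  refine Finset.sum_congr rfl fun a _ => ?_
  rw [Matrix.diag_apply, LinearMap.toMatrix_apply]
  have hb : ∀ c, b c = e c := fun c => by simp [b]
  have h := orth_expand B e s hs hob (T (e a)) (hspan trivial)
  have hr : b.repr (T (e a)) a = s a * B (T (e a)) (e a) := by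
    have h2 : T (e a) = ∑ c, (s c * B (T (e a)) (e c)) • b c := by
      simp_rw [hb]
      exact h
    conv_lhs => rw [h2]
    rw [b.repr_sum_self]
  rw [hb, hr]


/-- **Proposition 4.1.**  Ricci tensor of a 2-step nilpotent
metric Lie algebra with nondegenerate center: with `z` the center, `v = z^⊥`,
`j` the associated map, `∇` the Levi-Civita product,
`R(x,y) = ∇_x∇_y − ∇_y∇_x − ∇_{[x,y]}` and `Ric(x,y) = tr(w ↦ R(w,x)y)`, and
orthonormal bases `{z_i}` of `z` and `{v_k}` of `v` with `ε_i = ⟨z_i, z_i⟩`,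
`ε̄_k = ⟨v_k, v_k⟩`:  `Ric(x,y) = 0` for `x ∈ v, y ∈ z`;
`Ric(x,y) = ½ Σ_i ε_i ⟨j(z_i)²x, y⟩` for `x, y ∈ v`;  and
`Ric(x,y) = −¼ Σ_k ε̄_k ⟨j(x)j(y)v_k, v_k⟩` for `x, y ∈ z`. -/
theorem statement15 {n : Type} [LieRing n] [LieAlgebra ℝ n] [Module.Finite ℝ n]
    (B : LinearMap.BilinForm ℝ n) (hsymm : B.IsSymm) (hnd : B.Nondegenerate)
    (h2a : ∃ x y : n, ⁅x, y⁆ ≠ 0) (h2b : ∀ x y w : n, ⁅⁅x, y⁆, w⁆ = 0)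
    (z : Submodule ℝ n) (hz : ∀ x : n, x ∈ z ↔ ∀ y : n, ⁅x, y⁆ = 0)
    (hznd : (B.restrict z).Nondegenerate)
    (v : Submodule ℝ n) (hv : v = B.orthogonal z)
    (j : z →ₗ[ℝ] Module.End ℝ v)
    (hjdef : ∀ (x : z) (u w : v),
      B (j x u : n) (w : n) = B ⁅(u : n), (w : n)⁆ (x : n))
    -- `nab` is the Levi-Civita product of `(n, B)`:
    (nab : n →ₗ[ℝ] n →ₗ[ℝ] n)
    (hnab : ∀ x y w : n,
      B (nab x y) w = (B ⁅x, y⁆ w - B y ⁅x, w⁆ - B x ⁅y, w⁆) / 2)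
    -- `Ric (x, y) = trace (w ↦ R(w, x) y)` where
    -- `R(w, x)y = ∇_w ∇_x y − ∇_x ∇_w y − ∇_{[w,x]} y`:
    (Ric : n → n → ℝ)
    (hRic : ∀ x y : n, Ric x y = LinearMap.trace ℝ n
      (nab.flip (nab x y) - (nab x) ∘ₗ (nab.flip y)
        + (nab.flip y) ∘ₗ (LieAlgebra.ad ℝ n x)))
    -- `{z_i}` is an orthonormal basis of `z` with signs `ε`:
    {ι : Type} [Fintype ι] [DecidableEq ι] (zi : ι → z) (ε : ι → ℝ)
    (hε : ∀ i, ε i = 1 ∨ ε i = -1)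
    (hzob : ∀ i i', B (zi i : n) (zi i' : n) = if i = i' then ε i else 0)
    (hzspan : Submodule.span ℝ (Set.range fun i => (zi i : n)) = z)
    -- `{v_k}` is an orthonormal basis of `v` with signs `ε̄`:
    {κ : Type} [Fintype κ] [DecidableEq κ] (vk : κ → v) (ε' : κ → ℝ)
    (hε' : ∀ k, ε' k = 1 ∨ ε' k = -1)
    (hvob : ∀ k k', B (vk k : n) (vk k' : n) = if k = k' then ε' k else 0)
    (hvspan : Submodule.span ℝ (Set.range fun k => (vk k : n)) = v) :
    -- `Ric(x, y) = 0` for `x ∈ v`, `y ∈ z`: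
    (∀ (x : v) (y : z), Ric (x : n) (y : n) = 0) ∧
    -- `Ric(x, y) = ½ Σ_i ε_i ⟨j(z_i)² x, y⟩` for `x, y ∈ v`:
    (∀ x y : v, Ric (x : n) (y : n) =
      (1 / 2 : ℝ) * ∑ i, ε i * B (j (zi i) (j (zi i) x) : n) (y : n)) ∧
    -- `Ric(x, y) = −¼ Σ_k ε̄_k ⟨j(x) j(y) v_k, v_k⟩` for `x, y ∈ z`:
    (∀ x y : z, Ric (x : n) (y : n) =
      -(1 / 4 : ℝ) * ∑ k, ε' k * B (j x (j y (vk k)) : n) (vk k : n)) := by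
  have hs : ∀ x y, B x y = B y x := fun x y => hsymm.eq x y
  have hzv : ∀ x ∈ z, ∀ y ∈ v, B x y = 0 := by
    intro x hx y hy
    rw [hv] at hy
    exact hy x hx
  have hvz : ∀ x ∈ v, ∀ y ∈ z, B x y = 0 := fun x hx y hy => by rw [hs]; exact hzv y hy x hx
  have hbz : ∀ x y : n, ⁅x, y⁆ ∈ z := fun x y => (hz _).2 (h2b x y)
  have hzl : ∀ x ∈ z, ∀ y : n, ⁅x, y⁆ = 0 := fun x hx => (hz x).1 hx
  have hzr : ∀ x ∈ z, ∀ y : n, ⁅y, x⁆ = 0 := fun x hx y => by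
    rw [← lie_skew, hzl x hx, neg_zero]
  have hcompl : IsCompl z v := by
    rw [hv]
    exact LinearMap.BilinForm.isCompl_orthogonal_of_restrict_nondegenerate hsymm.isRefl hznd
  -- extensionality on both summands
  have hext : ∀ p q : n, (∀ w ∈ z, B p w = B q w) → (∀ w ∈ v, B p w = B q w) → p = q := by
    intro p q h1 h2
    have h3 : ∀ w, B (p - q) w = 0 := by
      intro w
      have hw : w ∈ z ⊔ v := by rw [hcompl.sup_eq_top]; trivial
      obtain ⟨a, ha, b, hb, rfl⟩ := Submodule.mem_sup.1 hw
      simp [h1 a ha, h2 b hb]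
    exact sub_eq_zero.1 (hnd.1 _ h3)
  -- explicit Levi-Civita product
  have nzz : ∀ x ∈ z, ∀ y ∈ z, nab x y = 0 := by
    intro x hx y hy
    refine hext _ _ ?_ ?_ <;> intro w hw <;> simp [hnab, hzl x hx, hzl y hy]
  have nvv : ∀ x ∈ v, ∀ y ∈ v, nab x y = (1 / 2 : ℝ) • ⁅x, y⁆ := by
    intro x hx y hy
    refine hext _ _ ?_ ?_ <;> intro w hw <;> rw [hnab]
    · simp [hzr w hw]
      ring
    · simp [hvz _ hx _ (hbz _ _), hvz _ hy _ (hbz _ _)]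
      ring
  have nzv : ∀ (x : z) (y : v), nab x y = -(1 / 2 : ℝ) • (j x y : n) := by
    intro x y
    refine hext _ _ ?_ ?_ <;> intro w hw <;> rw [hnab]
    · simp [hzr w hw, hzl x x.2, hvz _ (j x y).2 w hw]
    · have := hjdef x y ⟨w, hw⟩
      simp only at this
      simp [hzl x x.2, this, hs x ⁅(y : n), w⁆]
      ring
  have nvz : ∀ (x : v) (y : z), nab x y = -(1 / 2 : ℝ) • (j y x : n) := by
    intro x y
    refine hext _ _ ?_ ?_ <;> intro w hw <;> rw [hnab]
    · simp [hzr w hw, hzr y y.2, hvz _ (j y x).2 w hw]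
    · have := hjdef y x ⟨w, hw⟩
      simp only at this
      simp [hzr y y.2, hzl y y.2, this, hs y ⁅(x : n), w⁆]
      ring
  have jskew : ∀ (x : z) (u w : v), B (j x u : n) (w : n) = - B (u : n) (j x w : n) := by
    intro x u w
    rw [hs u, hjdef, hjdef, ← lie_skew, map_neg, LinearMap.neg_apply]
  have nskew : ∀ x p w : n, B (nab x p) w = - B p (nab x w) := by
    intro x p w
    rw [hs p, hnab, hnab, ← lie_skew w p, hs w, hs p]
    simp only [map_neg]
    ring
  -- the trace formula
  have key : ∀ x y : n, Ric x y =
      (∑ i, ε i * (B (nab (zi i) y) (nab x (zi i)))) +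
      ∑ k, ε' k * (B (nab (vk k) y) (nab x (vk k))
        - 1 / 2 * B ⁅x, (vk k : n)⁆ ⁅y, (vk k : n)⁆) := by
    intro x y
    have hterm : ∀ w : n, (w ∈ z ∨ w ∈ v) → B ((nab.flip (nab x y) - (nab x) ∘ₗ (nab.flip y)
        + (nab.flip y) ∘ₗ (LieAlgebra.ad ℝ n x)) w) w =
        B (nab w y) (nab x w) - 1 / 2 * B ⁅x, w⁆ ⁅y, w⁆ := by
      intro w hw
      have h1 : B (nab w (nab x y)) w = 0 := by
        have h0 : B ⁅w, nab x y⁆ w = 0 := by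
          rcases hw with hw | hw
          · simp [hzl w hw]
          · exact hzv _ (hbz _ _) _ hw
        rw [hnab, ← lie_skew (nab x y) w, map_neg, hs w ⁅_, _⁆, h0]
        simp
      have h3 : B (nab ⁅x, w⁆ y) w = -(1 / 2) * B ⁅x, w⁆ ⁅y, w⁆ := by
        rw [hnab, h2b, h2b]
        simp
        ring
      simp only [LinearMap.add_apply, LinearMap.sub_apply, LinearMap.comp_apply,
        LinearMap.flip_apply, LieAlgebra.ad_apply, map_add, map_sub]
      rw [h1, h3, nskew x]
      ring
    rw [hRic, orth_trace B (Sum.elim (fun i => (zi i : n)) (fun k => (vk k : n))) (Sum.elim ε ε')]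
    · rw [Fintype.sum_sum_type]
      simp only [Sum.elim_inl, Sum.elim_inr]
      congr 1
      · refine Finset.sum_congr rfl fun i _ => ?_
        rw [hterm _ (Or.inl (zi i).2), hzr _ (zi i).2]
        simp
      · refine Finset.sum_congr rfl fun k _ => ?_
        rw [hterm _ (Or.inr (vk k).2)]
    · rintro (i | k)
      · exact hε i
      · exact hε' k
    · rintro (i | k) (i' | k')
      · simp [hzob]
      · simp [hzv _ (zi i).2 _ (vk k').2]
      · simp [hvz _ (vk k).2 _ (zi i').2]
      · simp [hvob]
    · rw [Set.Sum.elim_range, Submodule.span_union, hzspan, hvspan, hcompl.sup_eq_top]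
  refine ⟨?_, ?_, ?_⟩
  · intro x y
    rw [key]
    have h1 : ∀ i, nab (zi i) (y : n) = 0 := fun i => nzz _ (zi i).2 _ y.2
    have h2 : ∀ k, B (j y (vk k) : n) ⁅(x : n), (vk k : n)⁆ = 0 :=
      fun k => hvz _ (j y (vk k)).2 _ (hbz _ _)
    simp [h1, nvz, nvv _ x.2 _ (vk _).2, hzl _ y.2, h2]
  · intro x y
    rw [key]
    have hk : ∀ k, ε' k * (B (nab (vk k) y) (nab x (vk k))
        - 1 / 2 * B ⁅(x : n), (vk k : n)⁆ ⁅(y : n), (vk k : n)⁆) =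
        ∑ i, -(3 / 4) * ε i * (ε' k * (B (j (zi i) x : n) (vk k) * B (j (zi i) y : n) (vk k))) := by
      intro k
      have hp := orth_parseval B hs (fun i => (zi i : n)) ε hε hzob ⁅(x : n), (vk k : n)⁆
        ⁅(y : n), (vk k : n)⁆ (by rw [hzspan]; exact hbz _ _)
      have : B (nab (vk k) y) (nab x (vk k)) =
          -(1 / 4) * B ⁅(x : n), (vk k : n)⁆ ⁅(y : n), (vk k : n)⁆ := by
        rw [nvv _ (vk k).2 _ y.2, nvv _ x.2 _ (vk k).2, ← lie_skew (vk k : n) (y : n),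
          hs ⁅(x : n), (vk k : n)⁆]
        simp only [smul_neg, map_neg, map_smul, LinearMap.neg_apply, LinearMap.smul_apply,
          smul_eq_mul]
        ring
      simp only [hjdef]
      rw [this, hp, Finset.mul_sum, Finset.mul_sum, ← Finset.sum_sub_distrib, Finset.mul_sum]
      refine Finset.sum_congr rfl fun i _ => ?_
      ring
    rw [Finset.sum_congr rfl fun k _ => hk k, Finset.sum_comm, Finset.mul_sum,
      ← Finset.sum_add_distrib]
    refine Finset.sum_congr rfl fun i _ => ?_
    rw [← Finset.mul_sum, ← orth_parseval B hs (fun k => (vk k : n)) ε' hε' hvob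
      (j (zi i) x : n) (j (zi i) y : n) (by rw [hvspan]; exact (j (zi i) x).2),
      jskew (zi i) (j (zi i) x) y, nzv, nvz, hs (j (zi i) x : n)]
    simp
    ring
  · intro x y
    rw [key]
    have h1 : ∀ i, nab (zi i) (y : n) = 0 := fun i => nzz _ (zi i).2 _ y.2
    simp only [h1, nvz, nzv, hzl _ y.2, map_zero, LinearMap.zero_apply, mul_zero,
      Finset.sum_const_zero, zero_add, sub_zero, Finset.mul_sum]
    refine Finset.sum_congr rfl fun k _ => ?_
    rw [jskew x (j y (vk k)) (vk k)]
    simp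
    ring
end

section
/- Let h_{2n+1} be the Heisenberg Lie algebra of dimension 2n+1 and let ⟨,⟩ be any metric on h_{2n+1} whose restriction to the one-dimensional center z is nondegenerate; write v = z^⊥, B = ⟨,⟩|_v, fix z₀ spanning z, and let t = j(z₀) ∈ so(v, B) be the associated map evaluated at z₀. Then (h_{2n+1}, ⟨,⟩) is naturally reductive with respect to h ⋉ h_{2n+1}, where h = Der(h_{2n+1}) ∩ so(h_{2n+1}, ⟨,⟩), and moreover h is isomorphic to the centralizer Z_{so(v,B)}(t) = {B' ∈ so(v, B) : B't = tB'}. -/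
/-- **Proposition 4.3.**  Let `h_{2m+1}` be the Heisenberg Lie
algebra (the 2-step nilpotent real Lie algebra of dimension `2m+1` whose
center is one-dimensional and equal to its commutator ideal), let `B` be any
metric on it whose restriction to the center `z` is nondegenerate, let
`v = z^⊥`, fix `z₀` spanning `z`, and let `t = j(z₀)`.  Then `(h_{2m+1}, B)`
is naturally reductive with respect to `h ⋉ h_{2m+1}`,
`h = Der(h_{2m+1}) ∩ so(h_{2m+1}, B)`, and `h` is isomorphic (via restriction
to `v`) to the centralizer `Z_{so(v, B|_v)}(t)`. -/
theorem statement16 (m : ℕ) {n : Type} [LieRing n] [LieAlgebra ℝ n]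
    [Module.Finite ℝ n]
    (B : LinearMap.BilinForm ℝ n) (hsymm : B.IsSymm) (hnd : B.Nondegenerate)
    (h2a : ∃ x y : n, ⁅x, y⁆ ≠ 0) (h2b : ∀ x y w : n, ⁅⁅x, y⁆, w⁆ = 0)
    (z : Submodule ℝ n) (hz : ∀ x : n, x ∈ z ↔ ∀ y : n, ⁅x, y⁆ = 0)
    -- `n` is the Heisenberg Lie algebra of dimension `2m+1`:
    (hdim : Module.finrank ℝ n = 2 * m + 1)
    (hzdim : Module.finrank ℝ z = 1)
    (hcomm : z = Submodule.span ℝ {w : n | ∃ a b : n, ⁅a, b⁆ = w})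
    -- the metric restricted to the center is nondegenerate:
    (hznd : (B.restrict z).Nondegenerate)
    (v : Submodule ℝ n) (hv : v = B.orthogonal z)
    (j : z →ₗ[ℝ] Module.End ℝ v)
    (hjdef : ∀ (x : z) (u w : v),
      B (j x u : n) (w : n) = B ⁅(u : n), (w : n)⁆ (x : n))
    -- `z₀` spans the center and `t = j(z₀)`:
    (z0 : z) (hspan : ∀ x : z, ∃ c : ℝ, x = c • z0) :
    -- `(h_{2m+1}, B)` is naturally reductive:
    IsNaturallyReductive n B ∧
    -- every `D ∈ h` vanishes on `z`, leaves `v` invariant, and its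
    -- restriction to `v` lies in the centralizer of `t = j(z₀)` in
    -- `so(v, B|_v)`:
    (∀ D : Module.End ℝ n, (∀ a b : n, D ⁅a, b⁆ = ⁅D a, b⁆ + ⁅a, D b⁆) →
      (∀ a b : n, B (D a) b = - B a (D b)) →
      (∀ x : z, D (x : n) = 0) ∧
      ∃ hvinv : ∀ u : v, D (u : n) ∈ v,
        (∀ u w : v, B (D (u : n)) (w : n) = - B (u : n) (D (w : n))) ∧
        (∀ u : v, D (j z0 u : n) = (j z0 ⟨D (u : n), hvinv u⟩ : n))) ∧
    -- restriction to `v` is injective on `h`: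
    (∀ D₁ D₂ : Module.End ℝ n,
      (∀ a b : n, D₁ ⁅a, b⁆ = ⁅D₁ a, b⁆ + ⁅a, D₁ b⁆) →
      (∀ a b : n, B (D₁ a) b = - B a (D₁ b)) →
      (∀ a b : n, D₂ ⁅a, b⁆ = ⁅D₂ a, b⁆ + ⁅a, D₂ b⁆) →
      (∀ a b : n, B (D₂ a) b = - B a (D₂ b)) →
      (∀ u : v, D₁ (u : n) = D₂ (u : n)) → D₁ = D₂) ∧
    -- every element of the centralizer `Z_{so(v)}(t)` extends to an element
    -- of `h`:
    (∀ C : Module.End ℝ v,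
      (∀ u w : v, B (C u : n) (w : n) = - B (u : n) (C w : n)) →
      (∀ u : v, C (j z0 u) = j z0 (C u)) →
      ∃ D : Module.End ℝ n, (∀ a b : n, D ⁅a, b⁆ = ⁅D a, b⁆ + ⁅a, D b⁆) ∧
        (∀ a b : n, B (D a) b = - B a (D b)) ∧
        (∀ x : z, D (x : n) = 0) ∧ (∀ u : v, D (u : n) = (C u : n))) := by
  have sy : ∀ a b : n, B a b = B b a := fun a b => hsymm.eq a b
  have z0c : ∀ y : n, ⁅(z0 : n), y⁆ = 0 := (hz _).1 z0.2
  have z0c' : ∀ y : n, ⁅y, (z0 : n)⁆ = 0 := fun y => by rw [← lie_skew, z0c, neg_zero]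
  have hs : B (z0 : n) (z0 : n) ≠ 0 := by
    intro h0
    have hz0 : z0 = 0 := by
      apply hznd.1
      intro y
      obtain ⟨c, rfl⟩ := hspan y
      simp [h0]
    have hbot : ∀ x : z, x = 0 := by
      intro x
      obtain ⟨c, rfl⟩ := hspan x
      simp [hz0]
    have : Subsingleton z := ⟨fun a b => by rw [hbot a, hbot b]⟩
    rw [Module.finrank_zero_of_subsingleton] at hzdim
    exact absurd hzdim (by norm_num)
  have memv : ∀ x : n, x ∈ v ↔ B (z0 : n) x = 0 := by
    intro x
    rw [hv, LinearMap.BilinForm.mem_orthogonal_iff]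
    constructor
    · intro h
      exact h _ z0.2
    · intro h y hy
      obtain ⟨c, hc⟩ := hspan ⟨y, hy⟩
      have hc' : y = c • (z0 : n) := congrArg Subtype.val hc
      rw [hc']
      simp [h]
  have vz : ∀ u : v, B (z0 : n) (u : n) = 0 := fun u => (memv _).1 u.2
  have vz' : ∀ u : v, B (u : n) (z0 : n) = 0 := fun u => by rw [sy, vz]
  -- the projections
  obtain ⟨f, hf⟩ : ∃ f : n →ₗ[ℝ] ℝ, ∀ x, f x = (B z0 z0)⁻¹ * B z0 x :=
    ⟨(B z0 z0)⁻¹ • B z0, fun x => by simp⟩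
  obtain ⟨P, hP⟩ : ∃ P : n →ₗ[ℝ] v, ∀ x, (P x : n) = x - f x • (z0 : n) := by
    refine ⟨LinearMap.codRestrict v (LinearMap.id - f.smulRight (z0 : n)) ?_, fun x => rfl⟩
    intro x
    rw [memv]
    simp [hf]
    field_simp
    simp
  have dec : ∀ x : n, x = f x • (z0 : n) + (P x : n) := fun x => by rw [hP]; abel
  have fz0 : f z0 = 1 := by rw [hf]; field_simp
  have fv : ∀ u : v, f u = 0 := fun u => by rw [hf, vz]; simp
  have Pv : ∀ u : v, P u = u := fun u => Subtype.ext (by rw [hP, fv]; simp)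
  have Pz0 : P z0 = 0 := Subtype.ext (by rw [hP, fz0]; simp)
  have vext : ∀ a b : n, B z0 a = B z0 b → (∀ w : v, B a (w : n) = B b (w : n)) → a = b := by
    intro a b h1 h2
    rw [← sub_eq_zero]
    apply hnd.1
    intro x
    rw [dec x]
    simp [h2, sy a z0, sy b z0, h1]
  have brz : ∀ a b : n, ⁅a, b⁆ ∈ z := fun a b => (hz _).2 (fun y => h2b a b y)
  have br : ∀ a b : n, ⁅a, b⁆ = ((B z0 z0)⁻¹ * B (j z0 (P a) : n) (P b : n)) • (z0 : n) := by
    intro a b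
    have h1 : ⁅a, b⁆ = ⁅(P a : n), (P b : n)⁆ := by
      conv_lhs => rw [dec a, dec b]
      simp [z0c, z0c']
    obtain ⟨c, hc⟩ := hspan ⟨_, brz a b⟩
    have hc' : ⁅a, b⁆ = c • (z0 : n) := congrArg Subtype.val hc
    rw [hjdef, ← h1, hc']
    congr 1
    simp
    field_simp
  have tskew : ∀ u w : v, B (j z0 u : n) (w : n) = - B (u : n) (j z0 w : n) := by
    intro u w
    rw [sy u, hjdef, hjdef, ← lie_skew, map_neg, LinearMap.neg_apply]
  have Bdec : ∀ a b : n, B a b = f a * f b * B z0 z0 + B (P a : n) (P b : n) := by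
    intro a b
    conv_lhs => rw [dec a, dec b]
    simp [vz, vz']
    ring
  have ext : ∀ C : Module.End ℝ v,
      (∀ u w : v, B (C u : n) (w : n) = - B (u : n) (C w : n)) →
      (∀ u : v, C (j z0 u) = j z0 (C u)) →
      ∃ D : Module.End ℝ n, (∀ a b : n, D ⁅a, b⁆ = ⁅D a, b⁆ + ⁅a, D b⁆) ∧
        (∀ a b : n, B (D a) b = - B a (D b)) ∧
        (∀ x : z, D (x : n) = 0) ∧ (∀ u : v, D (u : n) = (C u : n)) ∧
        ∀ a : n, D a = (C (P a) : n) := by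
    intro C hC hCt
    have hD : ∀ a, (v.subtype ∘ₗ C ∘ₗ P) a = (C (P a) : n) := fun a => rfl
    refine ⟨v.subtype ∘ₗ C ∘ₗ P, ?_, ?_, ?_, ?_, hD⟩
    · intro a b
      simp only [hD]
      rw [br a b, br _ b, br a _, Pv, Pv, map_smul, Pz0, ← hCt, hC]
      simp
    · intro a b
      simp only [hD]
      rw [Bdec, Bdec a, fv, fv, Pv, Pv, hC]
      simp
    · intro x
      obtain ⟨c, rfl⟩ := hspan x
      simp [Pz0]
    · intro u
      rw [hD, Pv]
  have van : ∀ D : Module.End ℝ n, (∀ a b : n, D ⁅a, b⁆ = ⁅D a, b⁆ + ⁅a, D b⁆) →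
      (∀ a b : n, B (D a) b = - B a (D b)) → D (z0 : n) = 0 := by
    intro D h1 h2
    have hm : D (z0 : n) ∈ z := by
      rw [hz]
      intro y
      have := h1 z0 y
      rw [z0c, z0c, map_zero, add_zero] at this
      exact this.symm
    obtain ⟨c, hc⟩ := hspan ⟨_, hm⟩
    have hc' : D (z0 : n) = c • (z0 : n) := congrArg Subtype.val hc
    have h3 := h2 z0 z0
    rw [hc'] at h3
    simp only [map_smul, LinearMap.smul_apply, smul_eq_mul] at h3
    have h4 : c * B z0 z0 = 0 := by linarith
    rw [hc', (mul_eq_zero.1 h4).resolve_right hs, zero_smul]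
  refine ⟨?_, ?_, ?_, ?_⟩
  · obtain ⟨T, T1, T2, T3, T4, T5⟩ := ext (j z0) tskew (fun u => rfl)
    have hπ : ∀ x, (f.smulRight T) x = f x • T := fun x => rfl
    have hc : ∀ x y : n, ⁅f x • T, f y • T⁆ = 0 := by
      intro x y
      rw [Ring.lie_def, smul_mul_smul_comm, smul_mul_smul_comm, mul_comm, sub_self]
    refine ⟨f.smulRight T, ?_, ?_, ?_, ?_, ?_⟩
    · intro x a b
      simp [hπ, T1]
    · intro x a b
      simp [hπ, T2]
    · intro x y
      refine ⟨0, ?_⟩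
      rw [hπ, hπ, hc, map_zero]
    · intro x y
      rw [hπ, hπ, hπ, hc]
      simp [T5, fv]
    · intro x y w
      simp only [hπ, LinearMap.smul_apply, T5]
      rw [br x y, br x w, Bdec, Bdec y]
      simp only [map_add, map_sub, map_smul, fv, fz0, Pv, Pz0]
      have e := tskew (P y) (P w)
      have e2 := sy (P y) (j z0 (P x))
      simp [e, e2]
      field_simp
      ring
  · intro D h1 h2
    have h0 := van D h1 h2
    have hinv : ∀ u : v, D (u : n) ∈ v := by
      intro u
      rw [memv]
      have := h2 z0 u
      rw [h0] at this
      simpa using this.symm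
    refine ⟨?_, hinv, fun u w => h2 u w, ?_⟩
    · intro x
      obtain ⟨c, rfl⟩ := hspan x
      simp [h0]
    · intro u
      apply vext
      · rw [(memv _).1 (hinv _), vz]
      · intro w
        rw [h2, hjdef z0 _ w]
        have h3 := hjdef z0 u ⟨_, hinv w⟩
        simp only at h3
        rw [h3]
        have h4 := h1 u w
        have h5 : D ⁅(u : n), (w : n)⁆ = 0 := by
          rw [br]
          simp [h0]
        rw [h5] at h4
        rw [eq_neg_of_add_eq_zero_left h4.symm, map_neg, LinearMap.neg_apply]
  · intro D₁ D₂ a1 a2 b1 b2 h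
    ext x
    rw [dec x]
    simp [van D₁ a1 a2, van D₂ b1 b2, h]
  · intro C h1 h2
    obtain ⟨D, d1, d2, d3, d4, -⟩ := ext C h1 h2
    exact ⟨D, d1, d2, d3, d4⟩
end

section
/- Let n be a finite-dimensional 2-step nilpotent real Lie algebra with an ad-invariant metric ⟨,⟩. Then the orthogonal complement of the center satisfies z^⊥ = C(n), where C(n) = [n, n]; in particular C(n) is an isotropic subspace contained in z. Moreover, n decomposes as an orthogonal direct product of ideals n = z̃ × ñ, where z̃ is a central ideal on which ⟨,⟩ is nondegenerate, and ñ is an ideal on which ⟨,⟩ is nondegenerate whose center equals its commutator ideal (i.e. ñ has corank zero, the corank being dim z − dim C(n)). -/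
/-- Let `n` be a finite-dimensional 2-step nilpotent real
Lie algebra with an ad-invariant metric `B`.  Then `z^⊥ = C(n)`, where
`C(n) = [n, n]`; in particular `C(n)` is isotropic and contained in the center
`z`.  Moreover `n` is the orthogonal direct product of ideals `z̃ × ñ` where
`z̃` is a central ideal with `B|_{z̃}` nondegenerate and `ñ` is an ideal with
`B|_{ñ}` nondegenerate whose center equals its commutator ideal (corank
zero). -/
theorem statement18 {n : Type} [LieRing n] [LieAlgebra ℝ n] [Module.Finite ℝ n]
    (B : LinearMap.BilinForm ℝ n) (hsymm : B.IsSymm) (hnd : B.Nondegenerate)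
    -- `B` is ad-invariant:
    (hadinv : ∀ x y w : n, B ⁅x, y⁆ w + B y ⁅x, w⁆ = 0)
    -- `n` is 2-step nilpotent:
    (h2a : ∃ x y : n, ⁅x, y⁆ ≠ 0) (h2b : ∀ x y w : n, ⁅⁅x, y⁆, w⁆ = 0)
    -- `z` is the center and `Cn = C(n) = [n, n]` the commutator ideal:
    (z : Submodule ℝ n) (hz : ∀ x : n, x ∈ z ↔ ∀ y : n, ⁅x, y⁆ = 0)
    (Cn : Submodule ℝ n) (hCn : Cn = Submodule.span ℝ {w : n | ∃ a b : n, ⁅a, b⁆ = w}) :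
    -- `z^⊥ = C(n)`:
    B.orthogonal z = Cn ∧
    -- `C(n)` is isotropic and contained in the center:
    (∀ a ∈ Cn, ∀ b ∈ Cn, B a b = 0) ∧ Cn ≤ z ∧
    -- orthogonal decomposition `n = z̃ × ñ`:
    (∃ ztilde ntilde : Submodule ℝ n,
      -- `z̃` is a central ideal:
      ztilde ≤ z ∧
      -- `ñ` is an ideal:
      (∀ x ∈ ntilde, ∀ y : n, ⁅y, x⁆ ∈ ntilde) ∧
      -- `n = z̃ ⊕ ñ`, an orthogonal direct sum:
      ztilde ⊓ ntilde = ⊥ ∧ ztilde ⊔ ntilde = ⊤ ∧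
      (∀ a ∈ ztilde, ∀ b ∈ ntilde, B a b = 0) ∧
      -- the metric is nondegenerate on each factor:
      (B.restrict ztilde).Nondegenerate ∧ (B.restrict ntilde).Nondegenerate ∧
      -- `ñ` has corank zero: its center `z ⊓ ñ` equals its commutator
      -- ideal, which is `C(n)`:
      Cn ≤ ntilde ∧ z ⊓ ntilde = Cn) := by
  have hsy : ∀ x y : n, B x y = B y x := fun x y => by simpa using hsymm.eq x y
  have hrefl : B.IsRefl := hsymm.isRefl
  have hzC : B.orthogonal Cn = z := by
    ext x
    rw [LinearMap.BilinForm.mem_orthogonal_iff, hz]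
    constructor
    · intro h y
      have h0 : ⁅y, x⁆ = 0 := by
        refine hnd.2 _ fun b => ?_
        have h1 := h ⁅y, b⁆ (by rw [hCn]; exact Submodule.subset_span ⟨y, b, rfl⟩)
        have h2 := hadinv y b x
        have h3 : B ⁅y, b⁆ x = 0 := h1
        linarith
      rw [← lie_skew, h0, neg_zero]
    · intro h w hw
      change B w x = 0
      rw [hCn] at hw
      induction hw using Submodule.span_induction with
      | mem w hw =>
        obtain ⟨a, b, rfl⟩ := hw
        have h2 := hadinv a b x
        have h3 : ⁅a, x⁆ = 0 := by rw [← lie_skew, h, neg_zero]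
        rw [h3] at h2
        simpa using h2
      | zero => simp
      | add a b _ _ ha hb => simp [ha, hb]
      | smul c a _ ha => simp [ha]
  have hCz : Cn ≤ z := by
    rw [hCn, Submodule.span_le]
    rintro w ⟨a, b, rfl⟩
    exact (hz _).2 fun y => h2b a b y
  have hzo : B.orthogonal z = Cn := by
    rw [← hzC, LinearMap.BilinForm.orthogonal_orthogonal hnd hrefl]
  have hCz0 : ∀ a ∈ Cn, ∀ b ∈ z, B a b = 0 := by
    intro a ha b hb
    rw [← hzC] at hb
    exact hb a ha
  refine ⟨hzo, fun a ha b hb => hCz0 a ha b (hCz hb), hCz, ?_⟩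
  obtain ⟨K, hK⟩ := Submodule.exists_isCompl Cn
  have hdisj : ∀ x, x ∈ Cn → x ∈ K → x = 0 := fun x h1 h2 => by
    have : x ∈ Cn ⊓ K := ⟨h1, h2⟩
    rw [hK.inf_eq_bot] at this
    simpa using this
  have hsup : Cn ⊔ (K ⊓ z) = z := by
    rw [← sup_inf_assoc_of_le K hCz, hK.sup_eq_top, top_inf_eq]
  have key : ∀ x ∈ z, (∀ a ∈ K ⊓ z, B a x = 0) → x ∈ Cn := by
    intro x hx h
    rw [← hzo]
    intro y hy
    change B y x = 0
    rw [← hsup] at hy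
    obtain ⟨c, hc, k, hk, rfl⟩ := Submodule.mem_sup.1 hy
    simp [hCz0 c hc x hx, h k hk]
  have hndz : (B.restrict (K ⊓ z)).Nondegenerate := by
    constructor
    · rintro ⟨x, hx⟩ h
      have := key x hx.2 fun a ha => by rw [hsy]; exact h ⟨a, ha⟩
      exact Subtype.ext (hdisj x this hx.1)
    · rintro ⟨x, hx⟩ h
      have := key x hx.2 fun a ha => h ⟨a, ha⟩
      exact Subtype.ext (hdisj x this hx.1)
  have hcompl : IsCompl (K ⊓ z) (B.orthogonal (K ⊓ z)) :=
    LinearMap.BilinForm.isCompl_orthogonal_of_restrict_nondegenerate hrefl hndz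
  have hCle : Cn ≤ B.orthogonal (K ⊓ z) := by
    intro c hc a ha
    change B a c = 0
    rw [hsy]
    exact hCz0 c hc a ha.2
  refine ⟨K ⊓ z, B.orthogonal (K ⊓ z), inf_le_right, ?_, hcompl.inf_eq_bot, hcompl.sup_eq_top,
    fun a ha b hb => hb a ha, hndz, ?_, hCle, ?_⟩
  · intro x _ y
    apply hCle
    rw [hCn]
    exact Submodule.subset_span ⟨y, x, rfl⟩
  · have aux : ∀ x ∈ B.orthogonal (K ⊓ z), (∀ a ∈ B.orthogonal (K ⊓ z), B a x = 0) → x = 0 := by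
      intro x hx h
      refine hnd.2 x fun y => ?_
      have hy : y ∈ (K ⊓ z) ⊔ B.orthogonal (K ⊓ z) := by rw [hcompl.sup_eq_top]; trivial
      obtain ⟨c, hc, k, hk, rfl⟩ := Submodule.mem_sup.1 hy
      have h1 : B c x = 0 := hx c hc
      simp [h1, h k hk]
    constructor
    · rintro ⟨x, hx⟩ h
      exact Subtype.ext (aux x hx fun a ha => by rw [hsy]; exact h ⟨a, ha⟩)
    · rintro ⟨x, hx⟩ h
      exact Subtype.ext (aux x hx fun a ha => h ⟨a, ha⟩)
  · apply le_antisymm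
    · rintro x ⟨hx, hx'⟩
      exact key x hx fun a ha => hx' a ha
    · exact le_inf hCz hCle
end
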